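/- Let G = (V,E) be an infinite, locally finite, connected, transient digraph. Then there is at most one Gibbs measure on spanning in-arboreta of G rooted at infinity that is supported on configurations in which every component is one-ended; moreover, if such a measure exists, it equals the wired uniform spanning in-arboretum measure WUA_G. -/

import Mathlib

open MeasureTheory Filter Set
open scoped ENNReal

namespace DF

/-! ### Sequences over a countable state space -/

variable {S : Type}

/-- The number of transitions from `u` to `v` among the first `n` steps of the sequence `x`. -/
noncomputable def transCount (x : ℕ → S) (n : ℕ) (u v : S) : ℕ :=
  Set.ncard {i : ℕ | i < n ∧ x i = u ∧ x (i + 1) = v}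

/-- The equivalence `(x₀,…,xₙ) ≃ (y₀,…,yₙ)` of finite sequences: same initial state and the same
transition counts between every ordered pair of states. -/
def FinEquiv (x y : ℕ → S) (n : ℕ) : Prop :=
  x 0 = y 0 ∧ ∀ u v : S, transCount x n u v = transCount y n u v

/-- The equivalence `x ≃ y` of infinite sequences: they eventually agree and their initial
segments up to that point are `≃`-equivalent. -/
def InfEquiv (x y : ℕ → S) : Prop :=
  ∃ N : ℕ, (∀ n : ℕ, N ≤ n → x n = y n) ∧ FinEquiv x y N

/-- The transition numbers `M(u,v) = #{i ≥ 0 : (xᵢ, xᵢ₊₁) = (u,v)}` of an infinite sequence. -/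
noncomputable def transNum (x : ℕ → S) (u v : S) : ℕ∞ :=
  Set.encard {i : ℕ | x i = u ∧ x (i + 1) = v}

/-- The sigma-algebra on `S^ℕ` generated by the transition numbers. -/
noncomputable def transSigma (S : Type) : MeasurableSpace (ℕ → S) :=
  ⨆ u : S, ⨆ v : S, MeasurableSpace.comap (fun x => transNum x u v) (⊤ : MeasurableSpace ℕ∞)

/-- The tail sigma-algebra `⋂ₙ σ(Xₙ, Xₙ₊₁, …)` on `S^ℕ`. -/
def tailSigma (S : Type) [MeasurableSpace S] : MeasurableSpace (ℕ → S) :=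
  ⨅ n : ℕ, MeasurableSpace.comap (fun (x : ℕ → S) (i : ℕ) => x (i + n))
    (inferInstance : MeasurableSpace (ℕ → S))

/-- A measure on `S^ℕ` is partially exchangeable if any two `≃`-equivalent finite initial
segments have the same probability. -/
def PartiallyExchangeable [MeasurableSpace S] (μ : Measure (ℕ → S)) : Prop :=
  ∀ (n : ℕ) (x y : ℕ → S), FinEquiv x y n →
    μ {ω | ∀ i ≤ n, ω i = x i} = μ {ω | ∀ i ≤ n, ω i = y i}

/-- The set of partially exchangeable probability measures on `S^ℕ`. -/
def PEProb (S : Type) [MeasurableSpace S] : Set (Measure (ℕ → S)) :=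
  {μ | μ Set.univ = 1 ∧ PartiallyExchangeable μ}

/-- `μ` is an extreme point of the convex set of partially exchangeable probability measures. -/
def IsExtremePE [MeasurableSpace S] (μ : Measure (ℕ → S)) : Prop :=
  μ ∈ PEProb S ∧
    ∀ μ₁ ∈ PEProb S, ∀ μ₂ ∈ PEProb S, ∀ t : ℝ≥0∞, 0 < t → t < 1 →
      μ = t • μ₁ + (1 - t) • μ₂ → μ₁ = μ₂

/-! ### Digraphs -/

/-- A digraph on vertex set `V` with edge set `E`: each edge has a tail (`src`) and head (`dst`).
Multiple edges and loops are allowed. -/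
structure DigraphStruct (V E : Type) where
  src : E → V
  dst : E → V

namespace DigraphStruct

variable {V E : Type} (G : DigraphStruct V E)

def outEdges (v : V) : Set E := {e | G.src e = v}

def inEdges (v : V) : Set E := {e | G.dst e = v}

noncomputable def outDeg (v : V) : ℕ := (G.outEdges v).ncard

noncomputable def inDeg (v : V) : ℕ := (G.inEdges v).ncard

def LocallyFinite : Prop := ∀ v : V, (G.outEdges v).Finite ∧ (G.inEdges v).Finite

/-- Adjacency in the underlying undirected graph. -/
def undirAdj (u v : V) : Prop :=
  ∃ e : E, (G.src e = u ∧ G.dst e = v) ∨ (G.src e = v ∧ G.dst e = u)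

/-- `G` is connected as an undirected graph. -/
def Connected : Prop := ∀ u v : V, Relation.ReflTransGen G.undirAdj u v

def dirAdj (u v : V) : Prop := ∃ e : E, G.src e = u ∧ G.dst e = v

/-- One step along an edge of the edge set `B`. -/
def step (B : Set E) (u v : V) : Prop := ∃ e ∈ B, G.src e = u ∧ G.dst e = v

/-- `(G,o)` is an infinite sourced Eulerian digraph (with sink at infinity). -/
structure IsSourcedEulerian (o : V) : Prop where
  infinite : Infinite V
  locFin : G.LocallyFinite
  conn : G.Connected
  balanced : ∀ v : V, v ≠ o → G.inDeg v = G.outDeg v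
  source : G.outDeg o = G.inDeg o + 1

/-- The reversal of `G`: head and tail of every edge are exchanged. -/
def rev : DigraphStruct V E := ⟨G.dst, G.src⟩

/-- One-step transition probability of the random walk on `G`. -/
noncomputable def stepProb (u v : V) : ℝ≥0∞ :=
  ({e : E | G.src e = u ∧ G.dst e = v}.ncard : ℝ≥0∞) / (G.outDeg u : ℝ≥0∞)

open Classical in
/-- `μ` is the law of the random walk on `G` started at `o`, characterised through its cylinder
probabilities. -/
def IsWalkLaw [MeasurableSpace V] (o : V) (μ : Measure (ℕ → V)) : Prop :=
  μ Set.univ = 1 ∧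
    ∀ (n : ℕ) (x : ℕ → V),
      μ {ω | ∀ i ≤ n, ω i = x i} =
        if x 0 = o then ∏ i ∈ Finset.range n, G.stepProb (x i) (x (i + 1)) else 0

/-- `G` is transient: from every starting point, the random walk on `G` visits every vertex at
most finitely often almost surely. -/
def TransientDigraph [MeasurableSpace V] : Prop :=
  ∀ (o : V) (μ : Measure (ℕ → V)),
    G.IsWalkLaw o μ → μ {ω | ∀ v : V, {i : ℕ | ω i = v}.Finite} = 1

/-- An infinite path in `G` indexed by `ℕ`, encoded by its sequence of edges. -/
def IsInfPath (γ : ℕ → E) : Prop := ∀ i : ℕ, G.dst (γ i) = G.src (γ (i + 1))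

/-- A transient path: it visits every vertex at most finitely often. -/
def IsTransientPath (γ : ℕ → E) : Prop := ∀ v : V, {i : ℕ | G.src (γ i) = v}.Finite

/-- The edge set of the last-exit arboretum `𝓛(γ)`: the edges crossed by `γ` as it exits their
tail for the last time. -/
def lastExitSet (γ : ℕ → E) : Set E :=
  {e | ∃ i : ℕ, γ i = e ∧ ∀ j : ℕ, i < j → G.src (γ j) ≠ G.src (γ i)}

end DigraphStruct

/-! ### Finite paths, Eulerian paths, arborescences -/

/-- `IsPathList G o z P` means that the list of edges `P` forms a directed path from `o`
to `z` in `G`. -/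
def IsPathList {V E : Type} (G : DigraphStruct V E) : V → V → List E → Prop
  | o, z, [] => o = z
  | o, z, e :: es => G.src e = o ∧ IsPathList G (G.dst e) z es

/-- `P` is an Eulerian path from `o` to `z`: a path crossing every edge exactly once. -/
def IsEulerList {V E : Type} (G : DigraphStruct V E) (o z : V) (P : List E) : Prop :=
  IsPathList G o z P ∧ P.Nodup ∧ ∀ e : E, e ∈ P

/-- `B` is (the edge set of) a spanning in-arborescence of `G` rooted at `z`. -/
def IsFinArb {V E : Type} (G : DigraphStruct V E) (z : V) (B : Set E) : Prop :=
  (∀ e ∈ B, G.src e ≠ z) ∧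
  (∀ v : V, v ≠ z → ∃! e : E, e ∈ B ∧ G.src e = v) ∧
  (∀ v : V, Relation.ReflTransGen (G.step B) v z)

/-- `(G,o,z)` is a finite Eulerian digraph with source `o` and sink `z`. -/
structure IsFinEulerian {V E : Type} (G : DigraphStruct V E) (o z : V) : Prop where
  finV : Finite V
  finE : Finite E
  reach_from : ∀ v : V, Relation.ReflTransGen G.dirAdj o v
  reach_to : ∀ v : V, Relation.ReflTransGen G.dirAdj v z
  bal_ne : o ≠ z → (∀ v : V, v ≠ o → v ≠ z → G.inDeg v = G.outDeg v) ∧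
      G.outDeg o = G.inDeg o + 1 ∧ G.inDeg z = G.outDeg z + 1
  bal_eq : o = z → ∀ v : V, G.inDeg v = G.outDeg v

/-! ### Wired uniform spanning in-arborescences -/

/-- An exhaustion of the vertex set by finite subsets. -/
def IsExhaustion {V : Type} (Vn : ℕ → Set V) : Prop :=
  (∀ n, (Vn n).Finite) ∧ (∀ n, Vn n ⊆ Vn (n + 1)) ∧ (⋃ n, Vn n) = Set.univ

/-- `B` is (the edge set of) a spanning in-arborescence of the wired graph `G_U^*`
(all vertices outside `U` identified to a single boundary vertex) rooted at the boundary. -/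
def IsWiredArb {V E : Type} (G : DigraphStruct V E) (U : Set V) (B : Set E) : Prop :=
  (∀ e ∈ B, G.src e ∈ U) ∧ (∀ v ∈ U, ∃! e : E, e ∈ B ∧ G.src e = v) ∧
  (∀ v ∈ U, ∃ v' : V, v' ∉ U ∧ Relation.ReflTransGen (G.step B) v v')

/-- The probability, under the uniform spanning in-arborescence of the wired graph `G_U^*`
rooted at the boundary, that all edges of `F` are present. -/
noncomputable def wiredUACyl {V E : Type} (G : DigraphStruct V E) (U : Set V) (F : Finset E) :
    ℝ≥0∞ :=
  (Nat.card {B : Set E // IsWiredArb G U B ∧ (F : Set E) ⊆ B} : ℝ≥0∞) /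
    (Nat.card {B : Set E // IsWiredArb G U B} : ℝ≥0∞)

/-- `κ` is the law of the wired uniform spanning in-arboretum of `G` (as a random edge set,
encoded as an element of `E → Bool`): its cylinder probabilities are the limits along any
exhaustion of the uniform spanning in-arborescence measures of the wired graphs. -/
def IsWUALaw {V E : Type} (G : DigraphStruct V E) (κ : Measure (E → Bool)) : Prop :=
  κ Set.univ = 1 ∧
    ∀ Vn : ℕ → Set V, IsExhaustion Vn → ∀ F : Finset E,
      Filter.Tendsto (fun n => wiredUACyl G (Vn n) F) Filter.atTop
        (nhds (κ {A | ∀ e ∈ F, A e = true}))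

/-- A spanning in-arboretum rooted at infinity all of whose components are one-ended:
every vertex has out-degree exactly one, and the past of every vertex is finite. -/
def IsOneEndedSpanningArb {V E : Type} (G : DigraphStruct V E) (A : Set E) : Prop :=
  (∀ v : V, ∃! e : E, e ∈ A ∧ G.src e = v) ∧
    ∀ v : V, {u : V | Relation.ReflTransGen (G.step A) u v}.Finite

/-! ### Proper Gibbs measures on Eulerian paths -/

/-- `w` is a finite path in `G` starting at `o` (encoded by its edges). -/
def PrefixPath {V E : Type} (G : DigraphStruct V E) (o : V) {n : ℕ} (w : Fin n → E) : Prop :=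
  (∀ h : 0 < n, G.src (w ⟨0, h⟩) = o) ∧
    ∀ (i : ℕ) (h : i + 1 < n), G.dst (w ⟨i, Nat.lt_of_succ_lt h⟩) = G.src (w ⟨i + 1, h⟩)

/-- A proper Gibbs measure on Eulerian paths from `o` to `∞` in `G`: a probability measure on
edge sequences, supported on half-infinite paths started at `o` crossing every edge exactly once,
such that conditionally on the steps after time `n` the first `n` steps are a uniform Eulerian
path (from `o`, in the digraph spanned by the edges not crossed after time `n`, to the position
at time `n`). Uniformity is expressed by invariance under replacing the first `n` steps by any
other path from `o` crossing the same set of edges. -/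
def ProperGibbs {V E : Type} [MeasurableSpace E] (G : DigraphStruct V E) (o : V)
    (μ : Measure (ℕ → E)) : Prop :=
  μ Set.univ = 1 ∧
  μ {γ | (∀ i : ℕ, G.dst (γ i) = G.src (γ (i + 1))) ∧ G.src (γ 0) = o ∧ Function.Bijective γ}
      = 1 ∧
  ∀ (n : ℕ) (w w' : Fin n → E), Function.Injective w → Function.Injective w' →
    Set.range w = Set.range w' → PrefixPath G o w → PrefixPath G o w' →
    ∀ B : Set (ℕ → E),
      μ {γ | (∀ i : Fin n, γ (i : ℕ) = w i) ∧ (fun t : ℕ => γ (n + t)) ∈ B} =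
        μ {γ | (∀ i : Fin n, γ (i : ℕ) = w' i) ∧ (fun t : ℕ => γ (n + t)) ∈ B}

/-! ### Loop erasure and Wilson's algorithm rooted at infinity -/

/-- The loop-erasure times of the (transient) vertex sequence `p`:
`t₀ = 0`, `tᵢ₊₁ = 1 + max {t ≥ tᵢ : p t = p tᵢ}`. -/
noncomputable def leTimes {V : Type} (p : ℕ → V) : ℕ → ℕ
  | 0 => 0
  | i + 1 => sSup {t : ℕ | leTimes p i ≤ t ∧ p t = p (leTimes p i)} + 1

/-- The loop-erasure times of the vertex sequence `p` run up to time `k`. -/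
noncomputable def leTimesF {V : Type} (p : ℕ → V) (k : ℕ) : ℕ → ℕ
  | 0 => 0
  | i + 1 => sSup {t : ℕ | leTimesF p k i ≤ t ∧ t ≤ k ∧ p t = p (leTimesF p k i)} + 1

/-- The set of vertices incident to an edge of `A`. -/
def vertsOf {V E : Type} (G : DigraphStruct V E) (A : Set E) : Set V :=
  {u | ∃ e ∈ A, G.src e = u ∨ G.dst e = u}

open Classical in
/-- The set of edges of the loop-erasure of the walk `x` (an edge sequence) stopped when it
first hits `U`; if it never hits `U`, the loop-erasure of the whole (transient) walk. -/
noncomputable def stoppedLEedges {V E : Type} (G : DigraphStruct V E) (U : Set V) (x : ℕ → E) :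
    Set E :=
  if ∃ t : ℕ, G.src (x t) ∈ U then
    {e | ∃ i : ℕ,
      leTimesF (fun t => G.src (x t)) (sInf {t : ℕ | G.src (x t) ∈ U}) i <
          sInf {t : ℕ | G.src (x t) ∈ U} ∧
        x (leTimesF (fun t => G.src (x t)) (sInf {t : ℕ | G.src (x t) ∈ U}) i) = e}
  else Set.range fun i => x (leTimes (fun t => G.src (x t)) i)

/-- The partial edge sets generated by Wilson's algorithm rooted at infinity, run with the
enumeration `v` of the vertices and with `W j` the random walk used at stage `j + 1`
(started at `v j`). -/
noncomputable def wilsonA {V E : Type} (G : DigraphStruct V E) (v : ℕ → V) (W : ℕ → ℕ → E) :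
    ℕ → Set E
  | 0 => ∅
  | j + 1 =>
      wilsonA G v W j ∪
        stoppedLEedges G (vertsOf G (wilsonA G v W j) ∪ {u | ∃ i < j, v i = u}) (W j)

open Classical in
/-- Cylinder probabilities for the random walk on `G` started at `v`, recorded as a sequence of
edges: the probability that the first `n` crossed edges are `x 0, …, x (n-1)`. -/
noncomputable def edgeWalkCyl {V E : Type} (G : DigraphStruct V E) (v : V) (x : ℕ → E) (n : ℕ) :
    ℝ≥0∞ :=
  if (0 < n → G.src (x 0) = v) ∧ (∀ i : ℕ, i + 1 < n → G.dst (x i) = G.src (x (i + 1))) then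
    ∏ i ∈ Finset.range n, ((G.outDeg (G.src (x i)) : ℝ≥0∞))⁻¹
  else 0

/-- `P` is the joint law of a sequence of independent random walks on `G`, the `j`-th walk
started at `v j`. -/
def IsIndepWalksLaw {V E : Type} [MeasurableSpace E] (G : DigraphStruct V E) (v : ℕ → V)
    (P : Measure (ℕ → ℕ → E)) : Prop :=
  P Set.univ = 1 ∧
    ∀ (m n : ℕ) (x : ℕ → ℕ → E),
      P {ω | ∀ j < m, ∀ t < n, ω j t = x j t} =
        ∏ j ∈ Finset.range m, edgeWalkCyl G (v j) (x j) n

/-- `μ` is the law of the random walk on `G` started at `o`, recorded as its sequence of crossed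
edges. -/
def IsEdgeWalkLaw {V E : Type} [MeasurableSpace E] (G : DigraphStruct V E) (o : V)
    (μ : Measure (ℕ → E)) : Prop :=
  μ Set.univ = 1 ∧ ∀ (n : ℕ) (x : ℕ → E), μ {ω | ∀ i < n, ω i = x i} = edgeWalkCyl G o x n

/-! ### Finite approximations and Gibbs measures on arboreta -/

/-- A finite digraph with vertices and edges labelled by natural numbers. -/
structure FinDigraph where
  VS : Finset ℕ
  ES : Finset ℕ
  fsrc : ℕ → ℕ
  fdst : ℕ → ℕ

/-- `B` is a spanning in-arborescence of the finite digraph `H` rooted at `z`. -/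
def FinDigraph.IsArb (H : FinDigraph) (z : ℕ) (B : Finset ℕ) : Prop :=
  B ⊆ H.ES ∧ (∀ e ∈ B, H.fsrc e ≠ z) ∧
  (∀ v ∈ H.VS, v ≠ z → ∃! e : ℕ, e ∈ B ∧ H.fsrc e = v) ∧
  (∀ v ∈ H.VS, Relation.ReflTransGen
      (fun a b => ∃ e ∈ B, H.fsrc e = a ∧ H.fdst e = b) v z)

/-- A finite digraph `H` with a distinguished vertex `z`, together with a partial isomorphism
to a digraph on `(V, E)`: vertex and edge domains `A`, `F` in `H` and maps `φV`, `φE` to `V`, `E`. -/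
structure PIso (V E : Type) where
  H : FinDigraph
  z : ℕ
  A : Finset ℕ
  F : Finset ℕ
  φV : ℕ → V
  φE : ℕ → E

/-- The data of `p` really is a partial isomorphism to `G`. -/
def PIso.Valid {V E : Type} (p : PIso V E) (G : DigraphStruct V E) : Prop :=
  ↑p.A ⊆ ↑p.H.VS ∧ ↑p.F ⊆ ↑p.H.ES ∧ p.z ∈ p.H.VS ∧
  Set.InjOn p.φV ↑p.A ∧ Set.InjOn p.φE ↑p.F ∧
  ∀ e ∈ p.F, p.H.fsrc e ∈ p.A ∧ p.H.fdst e ∈ p.A ∧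
    G.src (p.φE e) = p.φV (p.H.fsrc e) ∧ G.dst (p.φE e) = p.φV (p.H.fdst e)

/-- The partial isomorphism `p` identifies a neighbourhood of (a preimage of) `w`:
`w` is in the range of `φV` and `φE` maps the edges incident to its preimage bijectively onto
the edges incident to `w`. -/
def PIso.GoodAt {V E : Type} (p : PIso V E) (G : DigraphStruct V E) (w : V) : Prop :=
  ∃ w' ∈ p.A, p.φV w' = w ∧
    (∀ e' ∈ p.H.ES, (p.H.fsrc e' = w' ∨ p.H.fdst e' = w') → e' ∈ p.F) ∧
    ∀ e : E, (G.src e = w ∨ G.dst e = w) →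
      ∃! e' : ℕ, e' ∈ p.F ∧ (p.H.fsrc e' = w' ∨ p.H.fdst e' = w') ∧ p.φE e' = e

/-- `a` is a finite approximation to `G`: a sequence of finite digraphs with distinguished
vertices `zₙ` and partial isomorphisms to `G`, identifying larger and larger neighbourhoods of
every finite vertex set, with the distinguished vertices escaping to infinity. -/
def IsFinApproxSeq {V E : Type} (G : DigraphStruct V E) (a : ℕ → PIso V E) : Prop :=
  (∀ n, (a n).Valid G) ∧
  (∀ W : Finset V, ∃ N, ∀ n ≥ N, ∀ w ∈ W, (a n).GoodAt G w) ∧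
  (∀ W : Finset V, ∃ N, ∀ n ≥ N, ¬((a n).z ∈ (a n).A ∧ (a n).φV (a n).z ∈ (W : Set V)))

/-- The probability, under the uniform spanning in-arborescence of `p.H` rooted at `p.z`, that
every edge of `F` is in the image of the arborescence under the partial isomorphism. -/
noncomputable def pisoUACyl {V E : Type} (p : PIso V E) (F : Finset E) :
    ℝ≥0∞ :=
  (Nat.card {B : Finset ℕ // p.H.IsArb p.z B ∧ ∀ e ∈ F, ∃ e' ∈ B, e' ∈ p.F ∧ p.φE e' = e} :
      ℝ≥0∞) /
    (Nat.card {B : Finset ℕ // p.H.IsArb p.z B} : ℝ≥0∞)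

/-- `μ` (a measure on edge sets, encoded as elements of `E → Bool`) is a Gibbs measure on
spanning in-arboreta of `G` rooted at infinity: it is a weak limit of mixtures (over a random
finite approximation to `G`) of uniform spanning in-arborescence measures on finite
approximations to `G`. -/
def IsArbGibbs {V E : Type} (G : DigraphStruct V E) (μ : Measure (E → Bool)) : Prop :=
  μ Set.univ = 1 ∧
  ∃ (Ω : Type) (mΩ : MeasurableSpace Ω) (ν : @Measure Ω mΩ) (a : Ω → ℕ → PIso V E),
    ν Set.univ = 1 ∧ (∀ ω : Ω, IsFinApproxSeq G (a ω)) ∧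
    ∀ F : Finset E,
      Filter.Tendsto (fun n => ∫⁻ ω, pisoUACyl (a ω n) F ∂ν) Filter.atTop
        (nhds (μ {A : E → Bool | ∀ e ∈ F, A e = true}))

/-! ### Stacks -/

open Classical in
/-- The state (current vertex, remaining stacks) after `n` steps of following the stacks `σ`
starting from `o`: at each step we cross the edge at the front of the list at the current vertex
and delete it from the list (doing nothing if the list is empty). -/
noncomputable def stackState {V E : Type} (G : DigraphStruct V E) (o : V) (σ : V → List E) :
    ℕ → V × (V → List E)
  | 0 => (o, σ)
  | n + 1 =>
    let p := stackState G o σ n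
    match p.2 p.1 with
    | [] => p
    | e :: rest => (G.dst e, Function.update p.2 p.1 rest)

/-- The edge crossed at step `n` when following the stacks `σ` from `o` (`none` if the
current stack is exhausted). -/
noncomputable def stackEdge {V E : Type} (G : DigraphStruct V E) (o : V) (σ : V → List E)
    (n : ℕ) : Option E :=
  ((stackState G o σ n).2 (stackState G o σ n).1).head?

/-- The sigma-algebra on stack configurations. -/
noncomputable def stackMS (V E : Type) : MeasurableSpace (V → List E) :=
  @MeasurableSpace.pi V (fun _ => List E) fun _ => ⊤

open Classical in
/-- `ρ` is the law of the random stack configuration built from a random arboretum with law `κ`: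
place the arboretum edge at the bottom of the stack at each vertex, and an independent,
uniformly random ordering of the remaining outgoing edges on top of it. -/
def IsStackLaw {V E : Type} (G : DigraphStruct V E) (κ : Measure (E → Bool))
    (ρ : @Measure (V → List E) (stackMS V E)) : Prop :=
  ρ Set.univ = 1 ∧
    ∀ (K : Finset V) (s : V → List E),
      ρ {σ | ∀ v ∈ K, σ v = s v} =
        if ∀ v ∈ K, (s v).Nodup ∧ ∀ e : E, e ∈ s v ↔ G.src e = v then
          κ {A | ∀ v ∈ K, ∃ e : E, (s v).getLast? = some e ∧ A e = true} *
            ∏ v ∈ K, (((G.outDeg v - 1).factorial : ℝ≥0∞))⁻¹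
        else 0

/-! ### Markov chains -/

open Classical in
/-- `ν` is the law of the trajectory of a Markov chain with state space `S' ⊆ S`, transition
kernel `p` and deterministic initial state `s0`. -/
def IsMCLaw {S : Type} [MeasurableSpace S] (S' : Set S) (p : S → S → ℝ≥0∞) (s0 : S)
    (ν : Measure (ℕ → S)) : Prop :=
  ν Set.univ = 1 ∧ s0 ∈ S' ∧
  (∀ u ∈ S', (∑' v : S, p u v) = 1 ∧ ∀ v : S, p u v ≠ 0 → v ∈ S') ∧
  (∀ u : S, u ∉ S' → ∀ v : S, p u v = 0) ∧
  ∀ (n : ℕ) (y : ℕ → S),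
    ν {x | ∀ i ≤ n, x i = y i} =
      if y 0 = s0 then ∏ i ∈ Finset.range n, p (y i) (y (i + 1)) else 0

/-- `ν` is the law of the trajectory of a recurrent Markov chain on a subset of `S` with
non-random initial state: the chain returns to its initial state infinitely often a.s. -/
def IsRecMCLaw {S : Type} [MeasurableSpace S] (ν : Measure (ℕ → S)) : Prop :=
  ∃ (S' : Set S) (p : S → S → ℝ≥0∞) (s0 : S),
    IsMCLaw S' p s0 ν ∧ ν {x | {i : ℕ | x i = s0}.Infinite} = 1

/-- `ν` is the law of the sequence of vertices visited by (the unique) proper Gibbs measure on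
Eulerian paths from `o` to `∞` on a sourced Eulerian digraph whose vertex set is a subset
of `S`. -/
def IsGibbsVertexLaw {S : Type} [MeasurableSpace S] (ν : Measure (ℕ → S)) : Prop :=
  ∃ (Vs : Set S) (E : Type) (mE : MeasurableSpace E) (G : DigraphStruct (↥Vs) E) (o : ↥Vs),
    Countable E ∧ G.IsSourcedEulerian o ∧
    ∃ μp : @Measure (ℕ → E) (@MeasurableSpace.pi ℕ (fun _ => E) fun _ => mE),
      @ProperGibbs (↥Vs) E mE G o μp ∧
      ∀ A : Set (ℕ → S), MeasurableSet A →
        ν A = μp ((fun (γ : ℕ → E) (i : ℕ) => ((G.src (γ i) : S))) ⁻¹' A)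

/-- Concatenation of a finite list with an infinite sequence. -/
def concatSeq {S : Type} (l : List S) (y : ℕ → S) : ℕ → S :=
  fun i => if h : i < l.length then l.get ⟨i, h⟩ else y (i - l.length)

/-- `ν` is the law of a process following a uniform random Eulerian path on a finite Eulerian
digraph with source and sink whose vertex set is a subset of `S`, followed by the trajectory of
an (independent) recurrent Markov chain on a disjoint subset of `S` with non-random initial
state. -/
def IsMixedLaw {S : Type} [MeasurableSpace S] (ν : Measure (ℕ → S)) : Prop :=
  ∃ (Vf : Finset S) (Ef : Type) (_ : Finite Ef)
    (Gf : DigraphStruct {s : S // s ∈ Vf} Ef) (of zf : {s : S // s ∈ Vf})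
    (Vr : Set S) (p : S → S → ℝ≥0∞) (s1 : S) (νMC : Measure (ℕ → S)),
    IsFinEulerian Gf of zf ∧ Disjoint (↑Vf : Set S) Vr ∧
    IsMCLaw Vr p s1 νMC ∧ νMC {x | {i : ℕ | x i = s1}.Infinite} = 1 ∧
    ∀ A : Set (ℕ → S), MeasurableSet A →
      ν A =
        (∑' L : {L : List Ef // IsEulerList Gf of zf L},
            νMC ((fun y => concatSeq (((of : S)) ::
              (L : List Ef).map fun e => ((Gf.dst e : S))) y) ⁻¹' A)) /
          (Nat.card {L : List Ef // IsEulerList Gf of zf L} : ℝ≥0∞)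

set_option linter.unusedSectionVars false

section Walk
variable {V E : Type} (G : DigraphStruct V E)

/-- The finite set of outgoing edges. -/
noncomputable def outF (hlf : G.LocallyFinite) (v : V) : Finset E := (hlf v).1.toFinset

lemma mem_outF (hlf : G.LocallyFinite) (v : V) (e : E) : e ∈ outF G hlf v ↔ G.src e = v := by
  simp [outF, DigraphStruct.outEdges]

lemma card_outF (hlf : G.LocallyFinite) (v : V) : (outF G hlf v).card = G.outDeg v := by
  rw [DigraphStruct.outDeg, Set.ncard_eq_toFinset_card _ (hlf v).1, outF]

open Classical in
lemma stepProb_eq (hlf : G.LocallyFinite) (u v : V) :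
    G.stepProb u v = (∑ e ∈ outF G hlf u, if G.dst e = v then (1 : ℝ≥0∞) else 0) *
      ((outF G hlf u).card : ℝ≥0∞)⁻¹ := by
  rw [DigraphStruct.stepProb, ← card_outF G hlf, div_eq_mul_inv]
  congr 1
  rw [Finset.sum_boole]
  congr 1
  rw [← Set.ncard_coe_finset]
  congr 1
  ext e
  simp [mem_outF]

lemma tsum_stepProb (hlf : G.LocallyFinite) (u : V) (φ : V → ℝ≥0∞) :
    ∑' w, G.stepProb u w * φ w =
      (∑ e ∈ outF G hlf u, φ (G.dst e)) * ((outF G hlf u).card : ℝ≥0∞)⁻¹ := by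
  classical
  simp_rw [stepProb_eq G hlf, mul_right_comm _ _ (φ _)]
  rw [ENNReal.tsum_mul_right]
  congr 1
  simp_rw [Finset.sum_mul]
  rw [Summable.tsum_finsetSum (fun _ _ => ENNReal.summable)]
  refine Finset.sum_congr rfl fun e _ => ?_
  rw [tsum_eq_single (G.dst e)]
  · simp
  · intro w hw; simp [hw.symm]

lemma stepProb_le_one (u v : V) (hlf : G.LocallyFinite) : G.stepProb u v ≤ 1 := by
  classical
  rw [stepProb_eq G hlf, ← div_eq_mul_inv]
  apply ENNReal.div_le_of_le_mul
  rw [one_mul, Finset.sum_boole]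
  exact_mod_cast Finset.card_filter_le _ _

/-- `k`-step transition probabilities. -/
noncomputable def pE (y : V) : ℕ → V → ℝ≥0∞
  | 0, x => by classical exact if x = y then 1 else 0
  | n + 1, x => ∑' w, G.stepProb x w * pE y n w

/-- probability of avoiding `y` for the next `M` steps. -/
noncomputable def hE (y : V) : ℕ → V → ℝ≥0∞
  | 0, _ => 1
  | n + 1, x => ∑' w, G.stepProb x w * (by classical exact if w = y then 0 else hE y n w)

variable [Countable V] [MeasurableSpace V] [DiscreteMeasurableSpace V]

lemma measure_split (μ : Measure (ℕ → V)) (S : Set (ℕ → V)) (hS : MeasurableSet S) (n : ℕ) :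
    μ S = ∑' w, μ (S ∩ {ω | ω n = w}) := by
  rw [← measure_iUnion]
  · congr 1; ext ω; simp
  · intro a b hab
    apply Set.disjoint_left.2
    rintro ω ⟨_, h1⟩ ⟨_, h2⟩
    exact hab (h1.symm.trans h2)
  · intro w
    exact hS.inter ((measurable_pi_apply n) (measurableSet_singleton w) : MeasurableSet ((fun ω : ℕ → V => ω n) ⁻¹' {w}))

/-- cylinder -/
def cyl (n : ℕ) (x : ℕ → V) : Set (ℕ → V) := {ω | ∀ i ≤ n, ω i = x i}

lemma cyl_meas (n : ℕ) (x : ℕ → V) : MeasurableSet (cyl n x) := by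
  have : cyl n x = ⋂ i : ℕ, ⋂ (_ : i ≤ n), (fun ω : ℕ → V => ω i) ⁻¹' {x i} := by
    ext ω; simp [cyl]
  rw [this]
  exact MeasurableSet.iInter fun i => MeasurableSet.iInter fun _ =>
    measurable_pi_apply i (measurableSet_singleton _)

lemma coord_meas (n : ℕ) (s : Set V) : MeasurableSet {ω : ℕ → V | ω n ∈ s} :=
  measurable_pi_apply n (MeasurableSet.of_discrete (s := s))

lemma cyl_inter (n : ℕ) (x : ℕ → V) (w : V) :
    cyl n x ∩ {ω | ω (n+1) = w} = cyl (n+1) (Function.update x (n+1) w) := by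
  ext ω
  simp only [cyl, mem_inter_iff, mem_ofPred_eq]
  constructor
  · rintro ⟨h1, h2⟩ i hi
    rcases Nat.lt_or_ge i (n+1) with h | h
    · rw [Function.update_of_ne (by omega)]; exact h1 i (by omega)
    · have : i = n+1 := by omega
      subst this; simpa using h2
  · intro h
    refine ⟨fun i hi => ?_, by simpa using h (n+1) le_rfl⟩
    have := h i (by omega)
    rwa [Function.update_of_ne (by omega)] at this

lemma cyl_succ {o : V} {μ : Measure (ℕ → V)} (hμ : G.IsWalkLaw o μ) (n : ℕ) (x : ℕ → V) (w : V) :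
    μ (cyl (n+1) (Function.update x (n+1) w)) = μ (cyl n x) * G.stepProb (x n) w := by
  classical
  have h1 := hμ.2 (n+1) (Function.update x (n+1) w)
  have h2 := hμ.2 n x
  rw [cyl, cyl, h1, h2, Function.update_of_ne (by omega)]
  split_ifs
  · rw [Finset.prod_range_succ]
    congr 1
    · refine Finset.prod_congr rfl fun i hi => ?_
      have := Finset.mem_range.1 hi
      rw [Function.update_of_ne (by omega), Function.update_of_ne (by omega)]
    · rw [Function.update_of_ne (by omega), Function.update_self]
  · simp

def avoid (y : V) (n M : ℕ) : Set (ℕ → V) := {ω | ∀ j, 1 ≤ j → j ≤ M → ω (n + j) ≠ y}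

lemma avoid_meas (y : V) (n M : ℕ) : MeasurableSet (avoid y n M) := by
  have : avoid y n M = ⋂ j : ℕ, ⋂ (_ : 1 ≤ j), ⋂ (_ : j ≤ M), {ω : ℕ → V | ω (n+j) ∈ ({y}ᶜ : Set V)} := by
    ext ω; simp [avoid]
  rw [this]
  exact MeasurableSet.iInter fun i => MeasurableSet.iInter fun _ => MeasurableSet.iInter fun _ =>
    coord_meas _ _

lemma avoid_formula {o : V} {μ : Measure (ℕ → V)} (hμ : G.IsWalkLaw o μ) (y : V) (M : ℕ) :
    ∀ (n : ℕ) (x : ℕ → V), μ (cyl n x ∩ avoid y n M) = μ (cyl n x) * hE G y M (x n) := by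
  classical
  induction M with
  | zero =>
    intro n x
    have : avoid y n 0 = univ := by
      ext ω; simp only [avoid, mem_ofPred_eq, mem_univ, iff_true]; intro j h1 h2; omega
    simp [this, hE]
  | succ M ih =>
    intro n x
    rw [measure_split μ _ ((cyl_meas n x).inter (avoid_meas y n (M+1))) (n+1), hE,
      ← ENNReal.tsum_mul_left]
    refine tsum_congr fun w => ?_
    by_cases hw : w = y
    · have : cyl n x ∩ avoid y n (M+1) ∩ {ω | ω (n+1) = w} = ∅ := by
        ext ω
        simp only [mem_inter_iff, mem_ofPred_eq, mem_empty_iff_false, iff_false]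
        rintro ⟨⟨_, h⟩, h'⟩
        exact h 1 le_rfl (by omega) (h'.trans hw)
      rw [this]; simp [hw]
    · have : cyl n x ∩ avoid y n (M+1) ∩ {ω | ω (n+1) = w} =
          cyl (n+1) (Function.update x (n+1) w) ∩ avoid y (n+1) M := by
        rw [← cyl_inter]
        ext ω
        simp only [mem_inter_iff, avoid, mem_ofPred_eq]
        constructor
        · rintro ⟨⟨h1, h2⟩, h3⟩
          refine ⟨⟨h1, h3⟩, fun j hj hj' => ?_⟩
          have := h2 (j+1) (by omega) (by omega)
          rwa [show n + 1 + j = n + (j+1) by omega]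
        · rintro ⟨⟨h1, h3⟩, h2⟩
          refine ⟨⟨h1, fun j hj hj' => ?_⟩, h3⟩
          obtain rfl | hj2 := Nat.eq_or_lt_of_le hj
          · rw [h3]; exact hw
          · have := h2 (j-1) (by omega) (by omega)
            rwa [show n + 1 + (j-1) = n + j by omega] at this
      rw [this, ih, cyl_succ G hμ, Function.update_self, if_neg hw, mul_assoc]

lemma hit_formula {o : V} {μ : Measure (ℕ → V)} (hμ : G.IsWalkLaw o μ) (y : V) (M k : ℕ) :
    ∀ (n : ℕ) (x : ℕ → V), μ (cyl n x ∩ ({ω | ω (n+k) = y} ∩ avoid y (n+k) M)) =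
      μ (cyl n x) * (pE G y k (x n) * hE G y M y) := by
  classical
  induction k with
  | zero =>
    intro n x
    rw [pE]
    by_cases h : x n = y
    · have : cyl n x ∩ ({ω | ω (n+0) = y} ∩ avoid y (n+0) M) = cyl n x ∩ avoid y n M := by
        ext ω
        simp only [mem_inter_iff, cyl, mem_ofPred_eq, add_zero]
        constructor
        · rintro ⟨a, b, c⟩; exact ⟨a, c⟩
        · rintro ⟨a, c⟩; exact ⟨a, (a n le_rfl).trans h, c⟩
      rw [this, avoid_formula G hμ]; simp [h]
    · have : cyl n x ∩ ({ω | ω (n+0) = y} ∩ avoid y (n+0) M) = ∅ := by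
        ext ω
        simp only [mem_inter_iff, cyl, mem_ofPred_eq, add_zero, mem_empty_iff_false, iff_false]
        rintro ⟨a, b, c⟩; exact h ((a n le_rfl).symm.trans b)
      rw [this]; simp [h]
  | succ k ih =>
    intro n x
    have hms : MeasurableSet (cyl n x ∩ ({ω | ω (n+(k+1)) = y} ∩ avoid y (n+(k+1)) M)) :=
      (cyl_meas n x).inter ((coord_meas _ {y}).inter (avoid_meas y _ M))
    rw [measure_split μ _ hms (n+1), pE,
      ← ENNReal.tsum_mul_right, ← ENNReal.tsum_mul_left]
    refine tsum_congr fun w => ?_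
    rw [inter_right_comm, cyl_inter, show n + (k+1) = (n+1) + k by omega]
    have := ih (n+1) (Function.update x (n+1) w)
    change μ (_ ∩ ({ω | ω (n+1+k) = y} ∩ _)) = _
    rw [this, cyl_succ G hμ, Function.update_self]
    ring

lemma hit_formula0 {o : V} {μ : Measure (ℕ → V)} (hμ : G.IsWalkLaw o μ) (y : V) (M k : ℕ) :
    μ ({ω | ω k = y} ∩ avoid y k M) = pE G y k o * hE G y M y := by
  classical
  have h0 : μ (cyl 0 (fun _ => o)) = 1 := by
    rw [cyl, hμ.2]; simp
  have : IsProbabilityMeasure μ := ⟨hμ.1⟩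
  have := hit_formula G hμ y M k 0 (fun _ => o)
  rw [h0, one_mul, zero_add, inter_comm] at this
  rw [← this]
  exact (measure_inter_conull ((prob_compl_eq_zero_iff (cyl_meas _ _)).2 h0)).symm

lemma last_formula {o : V} {μ : Measure (ℕ → V)} (hμ : G.IsWalkLaw o μ) (y : V) :
    (∑' k, pE G y k o) * (⨅ M, hE G y M y) =
      μ (⋃ k, ({ω | ω k = y} ∩ ⋂ M, avoid y k M)) := by
  have : IsProbabilityMeasure μ := ⟨hμ.1⟩
  have anti : ∀ k, Antitone (fun M => ({ω : ℕ → V | ω k = y} ∩ avoid y k M)) := by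
    intro k M M' h ω ⟨a, b⟩
    exact ⟨a, fun j h1 h2 => b j h1 (h2.trans h)⟩
  have hm : ∀ k M, MeasurableSet ({ω : ℕ → V | ω k = y} ∩ avoid y k M) := fun k M =>
    (coord_meas k {y}).inter (avoid_meas y k M)
  have key : ∀ k, μ ({ω | ω k = y} ∩ ⋂ M, avoid y k M) = pE G y k o * ⨅ M, hE G y M y := by
    intro k
    rw [inter_iInter, Directed.measure_iInter]
    rotate_left
    · exact fun M => (hm k M).nullMeasurableSet
    · exact (anti k).directed_ge
    · exact ⟨0, measure_ne_top _ _⟩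
    simp_rw [hit_formula0 G hμ]
    rw [ENNReal.mul_iInf]
    intro h
    exfalso
    have := hit_formula0 G hμ y 0 k
    rw [hE, mul_one, h] at this
    exact measure_ne_top _ _ this
  rw [measure_iUnion, ← ENNReal.tsum_mul_right]
  · exact tsum_congr fun k => (key k).symm
  · have : ∀ a b, a < b → Disjoint ({ω : ℕ → V | ω a = y} ∩ ⋂ M, avoid y a M)
        ({ω : ℕ → V | ω b = y} ∩ ⋂ M, avoid y b M) := by
      intro a b hab
      apply Set.disjoint_left.2
      rintro ω ⟨_, h1⟩ ⟨h2, _⟩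
      have := mem_iInter.1 h1 (b - a) (b-a) (by omega) le_rfl
      rw [show a + (b-a) = b by omega] at this
      exact this h2
    intro a b hab
    rcases lt_or_gt_of_ne hab with h | h
    · exact this a b h
    · exact (this b a h).symm
  · intro k
    rw [inter_iInter]
    exact MeasurableSet.iInter (hm k)

theorem green_finite (htrans : G.TransientDigraph) (hex : ∀ o, ∃ μ, G.IsWalkLaw o μ) (x y : V) :
    (∑' k, pE G y k x) ≠ ⊤ := by
  have hesc : (⨅ M, hE G y M y) ≠ 0 := by
    obtain ⟨μ, hμ⟩ := hex y
    have : IsProbabilityMeasure μ := ⟨hμ.1⟩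
    intro h0
    have h1 := last_formula G hμ y
    rw [h0, mul_zero] at h1
    have h2 := htrans y μ hμ
    have h3 : μ (cyl 0 (fun _ => y)) = 1 := by
      classical
      rw [cyl, hμ.2]; simp
    have h4 := (measure_inter_conull (s := {ω : ℕ → V | ∀ v : V, {i : ℕ | ω i = v}.Finite}) ((prob_compl_eq_zero_iff (cyl_meas 0 (fun _ => y))).2 h3))
    rw [h2] at h4
    have h5 : cyl 0 (fun _ => y) ∩ {ω : ℕ → V | ∀ v : V, {i : ℕ | ω i = v}.Finite} ⊆
        (⋃ k, ({ω | ω k = y} ∩ ⋂ M, avoid y k M)) := by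
      rintro ω ⟨hω0, hω⟩
      have hne : {i : ℕ | ω i = y}.Nonempty := ⟨0, hω0 0 le_rfl⟩
      obtain ⟨k, hk, hmax⟩ := (hω y).exists_maximalFor id _ hne
      refine mem_iUnion.2 ⟨k, hk, mem_iInter.2 fun M j hj _ hy => ?_⟩
      have := hmax hy (by simp)
      simp at this
      omega
    have := measure_mono (μ := μ) h5
    rw [inter_comm, h4, ← h1] at this
    simp at this
  obtain ⟨μ, hμ⟩ := hex x
  have : IsProbabilityMeasure μ := ⟨hμ.1⟩
  have h1 := last_formula G hμ y
  intro htop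
  rw [htop, ENNReal.top_mul hesc] at h1
  exact measure_ne_top _ _ h1.symm

end Walk

section Exist
variable {V E : Type} (G : DigraphStruct V E)
variable [Countable V] [MeasurableSpace V] [DiscreteMeasurableSpace V]

/-- One step law of the walk. -/
noncomputable def stepMeas (hlf : G.LocallyFinite) (v : V) : Measure V :=
  ((outF G hlf v).card : ℝ≥0∞)⁻¹ • ∑ e ∈ outF G hlf v, Measure.dirac (G.dst e)

lemma stepMeas_singleton (hlf : G.LocallyFinite) (v w : V) :
    stepMeas G hlf v {w} = G.stepProb v w := by
  classical
  rw [stepProb_eq G hlf, stepMeas, mul_comm]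
  simp [Measure.finsetSum_apply, Set.indicator_apply]

lemma stepMeas_univ (hlf : G.LocallyFinite) (v : V) (hd : G.outDeg v ≠ 0) :
    stepMeas G hlf v univ = 1 := by
  rw [← card_outF G hlf] at hd
  simp only [stepMeas, Measure.smul_apply, Measure.finsetSum_apply, measure_univ, smul_eq_mul,
    Finset.sum_const, nsmul_eq_mul, mul_one]
  exact ENNReal.inv_mul_cancel (by exact_mod_cast hd) (by simp)

theorem exists_walkLaw (hlf : G.LocallyFinite) (hd : ∀ v, G.outDeg v ≠ 0) (o : V) :
    ∃ μ, G.IsWalkLaw o μ := by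
  classical
  let κ : (n : ℕ) → ProbabilityTheory.Kernel ((i : Finset.Iic n) → (fun _ : ℕ => V) i) ((fun _ : ℕ => V) (n+1)) :=
    fun n => ProbabilityTheory.Kernel.ofFunOfCountable
      (fun x => stepMeas G hlf (x ⟨n, by simp⟩))
  have hκ : ∀ n x, κ n x = stepMeas G hlf (x ⟨n, by simp⟩) := fun n x => rfl
  have : ∀ n, ProbabilityTheory.IsMarkovKernel (κ n) := fun n =>
    ⟨fun x => ⟨by rw [hκ]; exact stepMeas_univ G hlf _ (hd _)⟩⟩
  let μ := ProbabilityTheory.Kernel.traj (X := fun _ : ℕ => V) κ 0 (fun _ => o)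
  have hprob : IsProbabilityMeasure μ := inferInstance
  refine ⟨μ, measure_univ, ?_⟩
  intro n x
  induction n with
  | zero =>
    have h := ProbabilityTheory.Kernel.traj_map_frestrictLe_apply (X := fun _ : ℕ => V) (κ := κ) 0 0
      (fun _ => o)
    rw [ProbabilityTheory.Kernel.partialTraj_self, ProbabilityTheory.Kernel.id_apply] at h
    have e2 : {ω : ℕ → V | ∀ i ≤ 0, ω i = x i} = (Preorder.frestrictLe (π := fun _ => V) 0) ⁻¹'
        ({Preorder.frestrictLe 0 x}) := by
      ext ω
      simp only [mem_preimage, mem_singleton_iff, mem_ofPred_eq, funext_iff]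
      constructor
      · intro h i
        exact h i (Finset.mem_Iic.1 i.2)
      · intro h i hi
        exact h ⟨i, Finset.mem_Iic.2 hi⟩
    rw [e2, ← Measure.map_apply (by fun_prop) (measurableSet_singleton _), h]
    rw [Measure.dirac_apply' _ (measurableSet_singleton _), Set.indicator_apply]
    have : ((fun _ => o) ∈ ({Preorder.frestrictLe (π := fun _ : ℕ => V) 0 x} : Set _)) ↔ x 0 = o := by
      simp only [mem_singleton_iff, funext_iff]
      constructor
      · intro h; exact (h ⟨0, by simp⟩).symm
      · rintro h ⟨i, hi⟩
        have : i = 0 := by simpa using hi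
        subst this; exact h.symm
    simp [this]
  | succ n ih =>
    have h := ProbabilityTheory.Kernel.partialTraj_compProd_eq_map_traj
      (X := fun _ : ℕ => V) (κ := κ) (a := 0) (b := n) (Nat.zero_le n) (x₀ := fun _ => o)
    rw [← ProbabilityTheory.Kernel.traj_map_frestrictLe_apply] at h
    have h2 := congrArg (fun m => m ({Preorder.frestrictLe n x} ×ˢ {x (n+1)})) h
    rw [Measure.compProd_apply_prod (measurableSet_singleton _) (measurableSet_singleton _),
      Measure.map_apply (by fun_prop) ((measurableSet_singleton _).prod (measurableSet_singleton _)),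
      lintegral_singleton, Measure.map_apply (by fun_prop) (measurableSet_singleton _), hκ] at h2
    have e1 : (fun ω : ℕ → V => (Preorder.frestrictLe (π := fun _ => V) n ω, ω (n + 1))) ⁻¹'
        ({Preorder.frestrictLe n x} ×ˢ {x (n+1)}) = {ω | ∀ i ≤ n+1, ω i = x i} := by
      ext ω
      simp only [mem_preimage, mem_prod, mem_singleton_iff, mem_ofPred_eq, funext_iff]
      constructor
      · rintro ⟨h1, h2⟩ i hi
        rcases Nat.lt_or_ge i (n+1) with h | h
        · exact h1 ⟨i, by simp; omega⟩
        · have : i = n+1 := by omega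
          subst this; exact h2
      · intro h
        exact ⟨fun i => h i ((Finset.mem_Iic.1 i.2).trans (Nat.le_succ _)), h _ le_rfl⟩
    have e2 : (Preorder.frestrictLe (π := fun _ => V) n) ⁻¹'
        ({Preorder.frestrictLe n x}) = {ω | ∀ i ≤ n, ω i = x i} := by
      ext ω
      simp only [mem_preimage, mem_singleton_iff, mem_ofPred_eq, funext_iff]
      constructor
      · intro h i hi
        exact h ⟨i, by simpa⟩
      · intro h i
        exact h i (Finset.mem_Iic.1 i.2)
    erw [e1, e2] at h2
    erw [← h2, ih, stepMeas_singleton]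
    rw [mul_comm]
    split_ifs
    · rw [Finset.prod_range_succ]; rfl
    · simp

end Exist

section Green
variable {V E : Type} (G : DigraphStruct V E) (hlf : G.LocallyFinite)

open Classical in
/-- transition probabilities of the walk killed outside `K` -/
noncomputable def qK (K : Set V) (y : V) : ℕ → V → ℝ
  | 0, x => if x ∈ K ∧ x = y then 1 else 0
  | n + 1, x => if x ∈ K then (∑ e ∈ outF G hlf x, qK K y n (G.dst e)) / (outF G hlf x).card else 0

lemma qK_nonneg (K : Set V) (y : V) (n : ℕ) (x : V) : 0 ≤ qK G hlf K y n x := by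
  classical
  induction n generalizing x with
  | zero => rw [qK]; split_ifs <;> norm_num
  | succ n ih =>
    rw [qK]; split_ifs
    · exact div_nonneg (Finset.sum_nonneg fun e _ => ih _) (by positivity)
    · exact le_rfl

lemma qK_le (K : Set V) (y : V) (n : ℕ) (x : V) : qK G hlf K y n x ≤ qK G hlf univ y n x := by
  classical
  induction n generalizing x with
  | zero => rw [qK, qK]; split_ifs <;> simp_all
  | succ n ih =>
    rw [qK, qK, if_pos (mem_univ x)]; split_ifs
    · exact div_le_div_of_nonneg_right (Finset.sum_le_sum fun e _ => ih _) (by positivity)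
    · exact div_nonneg (Finset.sum_nonneg fun e _ => qK_nonneg _ _ _ _ _ _) (by positivity)

lemma qK_not_mem (K : Set V) (y : V) (n : ℕ) (x : V) (hx : x ∉ K) : qK G hlf K y n x = 0 := by
  cases n <;> simp [qK, hx]

lemma qK_eventually (y : V) (n : ℕ) (x : V) :
    ∀ᶠ K : Finset V in atTop, qK G hlf (K : Set V) y n x = qK G hlf univ y n x := by
  classical
  induction n generalizing x with
  | zero =>
    filter_upwards [eventually_ge_atTop {x}] with K hK
    have : x ∈ K := hK (by simp)
    simp [qK, this]
  | succ n ih =>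
    have : ∀ᶠ K : Finset V in atTop, ∀ e ∈ outF G hlf x,
        qK G hlf (K : Set V) y n (G.dst e) = qK G hlf univ y n (G.dst e) :=
      (Filter.eventually_all_finset _).2 fun e _ => ih _
    filter_upwards [eventually_ge_atTop {x}, this] with K hK h
    have hx : x ∈ K := hK (by simp)
    simp only [qK, mem_univ, if_true, Finset.mem_coe, hx]
    rw [Finset.sum_congr rfl h]

lemma qK_ofReal (hd : ∀ v, G.outDeg v ≠ 0) (y : V) (n : ℕ) (x : V) :
    ENNReal.ofReal (qK G hlf univ y n x) = pE G y n x := by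
  classical
  induction n generalizing x with
  | zero => rw [qK, pE]; split_ifs <;> simp_all
  | succ n ih =>
    have := hd x
    rw [← card_outF G hlf] at this
    rw [qK, pE, if_pos (mem_univ x), tsum_stepProb G hlf, ENNReal.ofReal_div_of_pos (by positivity),
      ENNReal.ofReal_sum_of_nonneg (fun e _ => qK_nonneg _ _ _ _ _ _), div_eq_mul_inv]
    simp [ih]

variable [Countable V] [MeasurableSpace V] [DiscreteMeasurableSpace V]

lemma qK_summable (hd : ∀ v, G.outDeg v ≠ 0) (htrans : G.TransientDigraph) (x y : V) :
    Summable (fun n => qK G hlf univ y n x) := by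
  have h := green_finite G htrans (exists_walkLaw G hlf hd) x y
  simp_rw [← qK_ofReal G hlf hd] at h
  have := ENNReal.summable_toReal h
  simpa [ENNReal.toReal_ofReal (qK_nonneg _ _ _ _ _ _)] using this

/-- Green function of the killed walk -/
noncomputable def gK (K : Set V) (y x : V) : ℝ := ∑' n, qK G hlf K y n x

lemma gK_tendsto (hd : ∀ v, G.outDeg v ≠ 0) (htrans : G.TransientDigraph) (x y : V) :
    Tendsto (fun K : Finset V => gK G hlf (K : Set V) y x) atTop (nhds (gK G hlf univ y x)) := by
  refine tendsto_tsum_of_dominated_convergence (qK_summable G hlf hd htrans x y) ?_ ?_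
  · intro n
    exact tendsto_const_nhds.congr' ((qK_eventually G hlf y n x).mono fun K h => h.symm)
  · refine Eventually.of_forall fun K n => ?_
    rw [Real.norm_of_nonneg (qK_nonneg _ _ _ _ _ _)]
    exact qK_le _ _ _ _ _ _

lemma gK_summable (hd : ∀ v, G.outDeg v ≠ 0) (htrans : G.TransientDigraph) (K : Set V) (x y : V) :
    Summable (fun n => qK G hlf K y n x) :=
  Summable.of_nonneg_of_le (fun n => qK_nonneg _ _ _ _ _ _) (fun n => qK_le _ _ _ _ _ _)
    (qK_summable G hlf hd htrans x y)

open Classical in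
lemma gK_eq (hd : ∀ v, G.outDeg v ≠ 0) (htrans : G.TransientDigraph) (K : Set V) (x y : V)
    (hx : x ∈ K) :
    ∑ e ∈ outF G hlf x, (gK G hlf K y x - gK G hlf K y (G.dst e)) =
      if x = y then (G.outDeg x : ℝ) else 0 := by
  have hs := gK_summable G hlf hd htrans K
  have h1 : gK G hlf K y x = (if x = y then 1 else 0) +
      (∑ e ∈ outF G hlf x, gK G hlf K y (G.dst e)) / (outF G hlf x).card := by
    rw [gK, (hs x y).tsum_eq_zero_add]
    congr 1
    · simp [qK, hx]
    · simp only [qK, hx, if_true]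
      rw [tsum_div_const, Summable.tsum_finsetSum (fun e _ => hs _ _)]
      rfl
  have hdx := hd x
  rw [← card_outF G hlf] at hdx ⊢
  rw [Finset.sum_sub_distrib, Finset.sum_const, nsmul_eq_mul, h1]
  field_simp
  by_cases h : x = y
  · subst h; simp
  · simp [h]

lemma gK_not_mem (K : Set V) (x y : V) (hx : x ∉ K) : gK G hlf K y x = 0 := by
  simp [gK, qK_not_mem G hlf K y _ x hx]

end Green

section Kirchhoff
variable {V E : Type} (G : DigraphStruct V E) (hlf : G.LocallyFinite)

open Classical in
/-- Follow the chosen edges inside `K`. -/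
noncomputable def nx (K : Finset V) (f : K → E) (u : V) : V :=
  if h : u ∈ K then G.dst (f ⟨u, h⟩) else u

/-- the choice `f` always exits `K`. -/
def Exits (K : Finset V) (f : K → E) : Prop := ∀ v : K, ∃ n, (nx G K f)^[n] v ∉ K

lemma step_range_iff (K : Finset V) (f : K → E) (hf : ∀ v, G.src (f v) = v) (u w : V) :
    G.step (range f) u w ↔ u ∈ K ∧ w = nx G K f u := by
  constructor
  · rintro ⟨e, ⟨v, rfl⟩, h1, h2⟩
    have : u = v := by rw [← h1, hf]
    subst this
    exact ⟨v.2, by simp [nx, ← h2]⟩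
  · rintro ⟨h, rfl⟩
    exact ⟨f ⟨u, h⟩, ⟨_, rfl⟩, hf _, by simp [nx, h]⟩

lemma exits_iff (K : Finset V) (f : K → E) (hf : ∀ v, G.src (f v) = v) :
    Exits G K f ↔ ∀ v ∈ (K : Set V), ∃ v', v' ∉ (K : Set V) ∧
      Relation.ReflTransGen (G.step (range f)) v v' := by
  constructor
  · intro h v hv
    obtain ⟨n, hn⟩ := h ⟨v, hv⟩
    refine ⟨_, hn, ?_⟩
    clear hn
    induction n with
    | zero => exact Relation.ReflTransGen.refl
    | succ n ih =>
      rw [Function.iterate_succ_apply']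
      by_cases hK : (nx G K f)^[n] v ∈ K
      · exact ih.tail ((step_range_iff G K f hf _ _).2 ⟨hK, rfl⟩)
      · rw [nx, dif_neg hK]; exact ih
  · rintro h v
    obtain ⟨v', hv', hp⟩ := h v v.2
    have : ∃ n, (nx G K f)^[n] v = v' := by
      clear hv'
      induction hp with
      | refl => exact ⟨0, rfl⟩
      | tail _ hs ih =>
        obtain ⟨n, hn⟩ := ih
        refine ⟨n+1, ?_⟩
        rw [Function.iterate_succ_apply', hn, ((step_range_iff G K f hf _ _).1 hs).2]
    obtain ⟨n, hn⟩ := this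
    exact ⟨n, hn ▸ hv'⟩

open Classical in
/-- row vector -/
noncomputable def rowV (K : Finset V) (v : K) (e : E) : K → ℝ :=
  fun w => (if v = w then 1 else 0) - (if G.dst e = w then 1 else 0)

open Classical in
lemma det_exits (K : Finset V) (f : K → E) (h : Exits G K f) :
    Matrix.det (fun v : K => rowV G K v (f v)) = 1 := by
  let b : K → ℕᵒᵈ := fun v => OrderDual.toDual (Nat.find (h v))
  have hb : ∀ v w : K, G.dst (f v) = w → Nat.find (h w) < Nat.find (h v) := by
    intro v w hvw
    have h1 := Nat.find_spec (h v)
    have h2 : Nat.find (h v) ≠ 0 := by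
      intro h0
      rw [h0] at h1
      exact h1 v.2
    obtain ⟨m, hm⟩ := Nat.exists_eq_succ_of_ne_zero h2
    rw [hm] at h1 ⊢
    rw [Function.iterate_succ_apply] at h1
    have : nx G K f v = w := by simp [nx, hvw]
    rw [this] at h1
    exact Nat.lt_succ_of_le (Nat.find_min' _ h1)
  have htri : Matrix.BlockTriangular (Matrix.of fun v : K => rowV G K v (f v)) b := by
    intro i j hij
    have hij' : Nat.find (h i) < Nat.find (h j) := hij
    simp only [Matrix.of_apply, rowV]
    rw [if_neg, if_neg, sub_zero]
    · intro h'; have := hb _ _ h'; omega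
    · rintro rfl; omega
  have := htri.det
  change Matrix.det (Matrix.of fun v : K => rowV G K v (f v)) = 1
  rw [this]
  apply Finset.prod_eq_one
  intro a _
  have : (Matrix.of fun v : K => rowV G K v (f v)).toSquareBlock b a = 1 := by
    ext i j
    rw [Matrix.toSquareBlock_def]
    have : Nat.find (h i) = Nat.find (h j) := by
      have := i.2.trans j.2.symm
      exact this
    simp only [Matrix.of_apply, rowV, Matrix.one_apply]
    rw [if_neg (c := G.dst _ = _), sub_zero]
    · by_cases hij : i = j
      · subst hij; simp
      · rw [if_neg hij, if_neg (fun h' => hij (Subtype.ext h'))]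
    · intro h'; have := hb _ _ h'; omega
  rw [this, Matrix.det_one]

open Classical in
lemma det_not_exits (K : Finset V) (f : K → E) (h : ¬ Exits G K f) :
    Matrix.det (fun v : K => rowV G K v (f v)) = 0 := by
  apply Matrix.exists_mulVec_eq_zero_iff.1
  simp only [Exits, not_forall, not_exists, not_not] at h
  obtain ⟨v0, hv0⟩ := h
  refine ⟨fun v => if ∀ n, (nx G K f)^[n] v ∈ K then 1 else 0, ?_, ?_⟩
  · intro h0
    have := congrFun h0 v0
    simp [hv0] at this
  · ext v
    simp only [Matrix.mulVec, dotProduct, rowV, sub_mul, Finset.sum_sub_distrib, Pi.zero_apply]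
    rw [Finset.sum_eq_single v (by intro b _ hb; simp [hb.symm]) (by simp), if_pos rfl, one_mul]
    have hnx : nx G K f v = G.dst (f v) := by simp [nx]
    by_cases hd : G.dst (f v) ∈ K
    · rw [Finset.sum_eq_single ⟨_, hd⟩]
      · rw [if_pos (c := G.dst _ = _) rfl, one_mul, sub_eq_zero]
        congr 1
        apply propext
        simp only [← hnx, ← Function.iterate_succ_apply]
        constructor
        · intro H n; exact H _
        · intro H n
          cases n with
          | zero => exact v.2
          | succ n => exact H n
      · intro b _ hb
        rw [if_neg, zero_mul]
        rintro h'; exact hb (Subtype.ext h'.symm)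
      · simp
    · rw [if_neg, Finset.sum_eq_zero, sub_zero]
      · intro b _
        rw [if_neg, zero_mul]
        rintro h'; exact hd (h' ▸ b.2)
      · intro H
        have := H 1
        rw [Function.iterate_one, hnx] at this
        exact hd this

open Classical in
/-- outgoing edges compatible with `F`. -/
noncomputable def outFF (F : Finset E) (v : V) : Finset E :=
  (outF G hlf v).filter fun e => ∀ e' ∈ F, G.src e' = v → e = e'

open Classical in
noncomputable def LF (K : Finset V) (F : Finset E) : Matrix K K ℝ :=
  fun v => ∑ e ∈ outFF G hlf F v, rowV G K v e

open Classical in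
lemma det_LF (K : Finset V) (F : Finset E) (hF : ∀ e ∈ F, G.src e ∈ K) :
    (LF G hlf K F).det =
      (Nat.card {B : Set E // IsWiredArb G K B ∧ (F : Set E) ⊆ B} : ℝ) := by
  have h1 : (LF G hlf K F).det = ∑ f ∈ Fintype.piFinset (fun v : K => outFF G hlf F v),
      Matrix.det (fun v : K => rowV G K v (f v)) :=
    MultilinearMap.map_sum_finset (Matrix.detRowAlternating (n := K) (R := ℝ)).toMultilinearMap
      (fun v e => rowV G K v e) (fun v : K => outFF G hlf F v)
  have h2 : ∀ f : K → E, Matrix.det (fun v : K => rowV G K v (f v)) = if Exits G K f then (1:ℝ) else 0 := by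
    intro f
    split_ifs with h
    · exact det_exits G K f h
    · exact det_not_exits G K f h
  rw [h1]
  simp_rw [h2]
  rw [Finset.sum_boole, ← Nat.card_eq_finsetCard]
  congr 1
  set T := (Fintype.piFinset (fun v : K => outFF G hlf F v)).filter (fun f => Exits G K f) with hT
  have hmem : ∀ f : K → E, f ∈ T ↔ (∀ v, G.src (f v) = v) ∧ (∀ v : K, ∀ e' ∈ F, G.src e' = v → f v = e') ∧ Exits G K f := by
    intro f
    simp only [hT, Finset.mem_filter, Fintype.mem_piFinset, outFF, mem_outF]
    constructor
    · rintro ⟨a, b⟩; exact ⟨fun v => (a v).1, fun v => (a v).2, b⟩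
    · rintro ⟨a, b, c⟩; exact ⟨fun v => ⟨a v, b v⟩, c⟩
  have hw : ∀ f ∈ T, IsWiredArb G K (range f) ∧ (F : Set E) ⊆ range f := by
    intro f hf
    obtain ⟨a, b, c⟩ := (hmem f).1 hf
    refine ⟨⟨?_, ?_, (exits_iff G K f a).1 c⟩, ?_⟩
    · rintro _ ⟨v, rfl⟩; rw [a]; exact v.2
    · intro v hv
      refine ⟨f ⟨v, hv⟩, ⟨⟨_, rfl⟩, a _⟩, ?_⟩
      rintro _ ⟨⟨w, rfl⟩, h⟩
      rw [a] at h
      congr 1; exact Subtype.ext h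
    · intro e he
      exact ⟨⟨G.src e, hF e he⟩, b _ e he rfl⟩
  refine Nat.card_eq_of_bijective (fun f : T => (⟨range f.1, hw f.1 f.2⟩ : {B : Set E // IsWiredArb G K B ∧ (F : Set E) ⊆ B})) ⟨?_, ?_⟩
  · rintro ⟨f, hf⟩ ⟨g, hg⟩ h
    have h : range f = range g := by simpa using h
    apply Subtype.ext
    funext v
    have : f v ∈ range g := h ▸ mem_range_self v
    obtain ⟨w, hw⟩ := this
    have h3 := ((hmem f).1 hf).1 v
    rw [← hw, ((hmem g).1 hg).1 w] at h3
    have : w = v := Subtype.ext h3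
    change f v = g v
    rw [← hw, this]
  · rintro ⟨B, hB, hFB⟩
    have h3 : ∀ v : K, ∃ e, e ∈ B ∧ G.src e = v := fun v => (hB.2.1 v v.2).exists
    choose f hf1 hf2 using h3
    have hr : range f = B := by
      ext e
      constructor
      · rintro ⟨v, rfl⟩; exact hf1 v
      · intro he
        exact ⟨⟨G.src e, hB.1 e he⟩, (hB.2.1 _ (hB.1 e he)).unique ⟨hf1 _, hf2 _⟩ ⟨he, rfl⟩⟩
    refine ⟨⟨f, (hmem f).2 ⟨hf2, ?_, ?_⟩⟩, ?_⟩
    · intro v e' he' h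
      exact (hB.2.1 _ v.2).unique ⟨hf1 _, hf2 _⟩ ⟨hFB he', h⟩
    · rw [exits_iff G K f hf2, hr]; exact hB.2.2
    · exact Subtype.ext hr

variable [Countable V] [MeasurableSpace V] [DiscreteMeasurableSpace V]

noncomputable def GamM (K : Finset V) : Matrix K K ℝ :=
  fun x y => gK G hlf (K : Set V) y x / G.outDeg y

open Classical in
lemma LF_mul (K : Finset V) (F : Finset E) (v y : K) :
    (LF G hlf K F * GamM G hlf K) v y = ∑ e ∈ outFF G hlf F v,
      (gK G hlf (K : Set V) y v - gK G hlf (K : Set V) y (G.dst e)) / G.outDeg y := by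
  rw [Matrix.mul_apply]
  simp only [LF, Finset.sum_apply, Finset.sum_mul]
  rw [Finset.sum_comm]
  refine Finset.sum_congr rfl fun e _ => ?_
  simp only [rowV, sub_mul, Finset.sum_sub_distrib, sub_div]
  rw [Finset.sum_eq_single v (by intro b _ hb; simp [hb.symm]) (by simp), if_pos rfl, one_mul]
  congr 1
  by_cases hd : G.dst e ∈ K
  · rw [Finset.sum_eq_single ⟨_, hd⟩]
    · simp [GamM]
    · intro b _ hb
      rw [if_neg, zero_mul]
      rintro h'; exact hb (Subtype.ext h'.symm)
    · simp
  · rw [gK_not_mem G hlf _ _ _ hd, zero_div, Finset.sum_eq_zero]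
    intro b _
    rw [if_neg, zero_mul]
    rintro h'; exact hd (h' ▸ b.2)

open Classical in
lemma LF_mul_row (hd : ∀ v, G.outDeg v ≠ 0) (htrans : G.TransientDigraph)
    (K : Finset V) (F : Finset E) (v y : K) (hv : ∀ e ∈ F, G.src e ≠ v) :
    (LF G hlf K F * GamM G hlf K) v y = if v = y then 1 else 0 := by
  rw [LF_mul]
  have : outFF G hlf F v = outF G hlf v := by
    apply Finset.filter_true_of_mem
    intro e _ e' he' h
    exact absurd h (hv e' he')
  rw [this, ← Finset.sum_div, gK_eq G hlf hd htrans _ _ _ v.2]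
  by_cases h : v = y
  · subst h
    have := hd v
    simp [this]
  · have : (v : V) ≠ y := fun h' => h (Subtype.ext h')
    simp [h, this]

open Classical in
/-- the finite determinant -/
noncomputable def smallM (K : Set V) (F : Finset E) : Matrix (F.image G.src) (F.image G.src) ℝ :=
  fun v y => ∑ e ∈ outFF G hlf F v,
      (gK G hlf (K : Set V) y v - gK G hlf (K : Set V) y (G.dst e)) / G.outDeg y

open Classical in
lemma det_ratio (hd : ∀ v, G.outDeg v ≠ 0) (htrans : G.TransientDigraph)
    (K : Finset V) (F : Finset E) (hF : ∀ e ∈ F, G.src e ∈ K) :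
    (LF G hlf K F * GamM G hlf K).det = (smallM G hlf (K : Set V) F).det := by
  rw [Matrix.twoBlockTriangular_det' _ (fun v : K => (v : V) ∉ F.image G.src)]
  · have h1 : Matrix.toSquareBlockProp (LF G hlf K F * GamM G hlf K) (fun v : K => (v : V) ∉ F.image G.src) = 1 := by
      ext i j
      rw [Matrix.toSquareBlockProp_def]
      simp only [Matrix.of_apply]
      rw [LF_mul_row G hlf hd htrans]
      · rw [Matrix.one_apply]
        by_cases hij : i = j
        · subst hij; simp
        · rw [if_neg hij, if_neg (fun h' => hij (Subtype.ext h'))]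
      · intro e he h
        exact i.2 (Finset.mem_image.2 ⟨e, he, h⟩)
    rw [h1, Matrix.det_one, one_mul]
    have hsub : ∀ v ∈ F.image G.src, v ∈ K := by
      intro v hv
      obtain ⟨e, he, rfl⟩ := Finset.mem_image.1 hv
      exact hF e he
    let eq : {v : K // ¬ (v : V) ∉ F.image G.src} ≃ ↥(F.image G.src) :=
      { toFun := fun v => ⟨v.1.1, not_not.1 v.2⟩
        invFun := fun v => ⟨⟨v.1, hsub v.1 v.2⟩, not_not.2 v.2⟩
        left_inv := fun v => rfl
        right_inv := fun v => rfl }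
    rw [← Matrix.det_submatrix_equiv_self eq (smallM G hlf (K : Set V) F)]
    congr 1
    ext i j
    rw [Matrix.toSquareBlockProp_def]
    simp only [Matrix.of_apply, LF_mul]
    rfl
  · intro i hi j hj
    rw [LF_mul_row G hlf hd htrans, if_neg]
    · rintro rfl; exact hj hi
    · intro e he h
      exact hi (Finset.mem_image.2 ⟨e, he, h⟩)

open Classical in
lemma LF_empty (hd : ∀ v, G.outDeg v ≠ 0) (htrans : G.TransientDigraph) (K : Finset V) :
    (LF G hlf K ∅).det * (GamM G hlf K).det = 1 := by
  rw [← Matrix.det_mul]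
  have : LF G hlf K ∅ * GamM G hlf K = 1 := by
    ext i j
    rw [LF_mul_row G hlf hd htrans _ _ _ _ (by simp), Matrix.one_apply]
  rw [this, Matrix.det_one]

lemma card_wired_ne (hlf : G.LocallyFinite) (hd : ∀ v, G.outDeg v ≠ 0) (htrans : G.TransientDigraph) (K : Finset V) :
    Nat.card {B : Set E // IsWiredArb G K B} ≠ 0 := by
  classical
  have h := LF_empty G hlf hd htrans K
  rw [det_LF G hlf K ∅ (by simp)] at h
  simp only [Finset.coe_empty, empty_subset, and_true] at h
  intro h0
  rw [h0] at h
  simp at h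

lemma wiredUACyl_eq (hd : ∀ v, G.outDeg v ≠ 0) (htrans : G.TransientDigraph)
    (K : Finset V) (F : Finset E) (hF : ∀ e ∈ F, G.src e ∈ K) :
    wiredUACyl G K F = ENNReal.ofReal (by classical exact (smallM G hlf (K : Set V) F).det) := by
  classical
  rw [← det_ratio G hlf hd htrans K F hF, Matrix.det_mul]
  have h0 := LF_empty G hlf hd htrans K
  have h1 := card_wired_ne G hlf hd htrans K
  have h2 : (GamM G hlf K).det = ((Nat.card {B : Set E // IsWiredArb G K B} : ℕ) : ℝ)⁻¹ := by
    rw [det_LF G hlf K ∅ (by simp)] at h0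
    simp only [Finset.coe_empty, empty_subset, and_true] at h0
    exact eq_inv_of_mul_eq_one_right h0
  rw [h2, det_LF G hlf K F hF, ← div_eq_mul_inv, ENNReal.ofReal_div_of_pos (by exact_mod_cast Nat.pos_of_ne_zero h1),
    ENNReal.ofReal_natCast, ENNReal.ofReal_natCast, wiredUACyl]

theorem wired_tendsto (hlf : G.LocallyFinite) (hd : ∀ v, G.outDeg v ≠ 0) (htrans : G.TransientDigraph) (F : Finset E) :
    ∃ L : ℝ≥0∞, Tendsto (fun K : Finset V => wiredUACyl G (K : Set V) F) atTop (nhds L) := by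
  classical
  refine ⟨ENNReal.ofReal (smallM G hlf univ F).det, ?_⟩
  have h : Tendsto (fun K : Finset V => ENNReal.ofReal (smallM G hlf (K : Set V) F).det) atTop
      (nhds (ENNReal.ofReal (smallM G hlf univ F).det)) := by
    refine (ENNReal.continuous_ofReal.tendsto _).comp ?_
    have hc : Continuous (fun M : Matrix (F.image G.src) (F.image G.src) ℝ => M.det) :=
      Continuous.matrix_det continuous_id
    refine (hc.tendsto _).comp ?_
    refine tendsto_pi_nhds.2 fun v => tendsto_pi_nhds.2 fun y => ?_
    refine tendsto_finsetSum _ fun e _ => ?_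
    exact ((gK_tendsto G hlf hd htrans _ _).sub (gK_tendsto G hlf hd htrans _ _)).div_const _
  refine h.congr' ?_
  filter_upwards [eventually_ge_atTop (F.image G.src)] with K hK
  rw [wiredUACyl_eq G hlf hd htrans]
  intro e he
  exact hK (Finset.mem_image_of_mem _ he)

end Kirchhoff

section Swap
variable {V E : Type} (G : DigraphStruct V E) (p : PIso V E)

open Classical in
noncomputable def arbs : Finset (Finset ℕ) := p.H.ES.powerset.filter (fun B => p.H.IsArb p.z B)

lemma mem_arbs (B : Finset ℕ) : B ∈ arbs p ↔ p.H.IsArb p.z B := by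
  simp only [arbs, Finset.mem_filter, Finset.mem_powerset, and_iff_right_iff_imp]
  exact fun h => h.1

/-- image edge set -/
def imE (B : Finset ℕ) : Set E := {e | ∃ e' ∈ B, e' ∈ p.F ∧ p.φE e' = e}

open Classical in
lemma pisoUACyl_eq (F : Finset E) : pisoUACyl p F =
    (((arbs p).filter (fun B => (F : Set E) ⊆ imE p B)).card : ℝ≥0∞) / ((arbs p).card : ℝ≥0∞) := by
  rw [pisoUACyl]
  congr 2
  · rw [← Nat.card_eq_finsetCard]
    refine Nat.card_congr (Equiv.subtypeEquivRight fun B => ?_)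
    simp only [Finset.mem_filter, mem_arbs]
    rfl
  · rw [← Nat.card_eq_finsetCard]
    exact Nat.card_congr (Equiv.subtypeEquivRight fun B => (mem_arbs p B).symm)

/-- step relation in the finite digraph -/
def fstep (B : Finset ℕ) (a b : ℕ) : Prop := ∃ e ∈ B, p.H.fsrc e = a ∧ p.H.fdst e = b

open Classical in
/-- preimage of vertex set -/
noncomputable def pre (K : Finset V) : Finset ℕ := p.A.filter (fun v => p.φV v ∈ K)

lemma mem_pre (K : Finset V) (v : ℕ) : v ∈ pre p K ↔ v ∈ p.A ∧ p.φV v ∈ K := by simp [pre]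

open Classical in
noncomputable def Kst (U : Finset V) (B : Finset ℕ) : Finset ℕ :=
  (pre p U).filter (fun v => ∀ u, Relation.ReflTransGen (fstep p B) u v → u ∈ pre p U)

lemma mem_Kst (U : Finset V) (B : Finset ℕ) (v : ℕ) : v ∈ Kst p U B ↔
    v ∈ pre p U ∧ ∀ u, Relation.ReflTransGen (fstep p B) u v → u ∈ pre p U := by simp [Kst]

open Classical in
noncomputable def swB (K : Finset V) (B : Finset ℕ) (C : Set E) : Finset ℕ :=
  B.filter (fun e => p.H.fsrc e ∉ pre p K) ∪
    p.F.filter (fun e => p.H.fsrc e ∈ pre p K ∧ p.φE e ∈ C)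

lemma mem_swB (K : Finset V) (B : Finset ℕ) (C : Set E) (e : ℕ) : e ∈ swB p K B C ↔
    (e ∈ B ∧ p.H.fsrc e ∉ pre p K) ∨ (e ∈ p.F ∧ p.H.fsrc e ∈ pre p K ∧ p.φE e ∈ C) := by
  simp [swB]

def swC (K : Finset V) (B : Finset ℕ) : Set E := {e | e ∈ imE p B ∧ G.src e ∈ K}

/-- closedness -/
def Clo (K : Finset V) (B : Finset ℕ) : Prop :=
  ∀ e ∈ B, p.H.fdst e ∈ pre p K → p.H.fsrc e ∈ pre p K

lemma path_out {K : Finset V} {B B1 : Finset ℕ} (hc : Clo p K B)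
    (h : ∀ e ∈ B, p.H.fsrc e ∉ pre p K → e ∈ B1) {u v : ℕ}
    (huv : Relation.ReflTransGen (fstep p B) u v) (hu : u ∉ pre p K) :
    Relation.ReflTransGen (fstep p B1) u v ∧ v ∉ pre p K := by
  induction huv with
  | refl => exact ⟨Relation.ReflTransGen.refl, hu⟩
  | tail _ hs ih =>
    obtain ⟨e, he, h1, h2⟩ := hs
    have h3 : p.H.fsrc e ∉ pre p K := h1 ▸ ih.2
    exact ⟨ih.1.tail ⟨e, h e he h3, h1, h2⟩, fun h4 => h3 (hc e he (h2 ▸ h4))⟩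

lemma path_in {K : Finset V} {B : Finset ℕ} (hc : Clo p K B) {u v : ℕ}
    (huv : Relation.ReflTransGen (fstep p B) u v) (hv : v ∈ pre p K) : u ∈ pre p K := by
  by_contra hu
  exact (path_out p (B1 := B) hc (fun _ h _ => h) huv hu).2 hv

lemma clo_of_Kst {K U : Finset V} {B : Finset ℕ} (h : Kst p U B = pre p K) : Clo p K B := by
  intro e he hd
  rw [← h, mem_Kst] at hd ⊢
  have : ∀ u, Relation.ReflTransGen (fstep p B) u (p.H.fsrc e) → u ∈ pre p U := fun u hu =>
    hd.2 u (hu.tail ⟨e, he, rfl, rfl⟩)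
  exact ⟨this _ Relation.ReflTransGen.refl, this⟩


lemma good_in (hv : p.Valid G) {K : Finset V} (hg : ∀ u ∈ K, p.GoodAt G u) {v : ℕ} (hvK : v ∈ pre p K)
    {e : ℕ} (he : e ∈ p.H.ES) (h : p.H.fsrc e = v ∨ p.H.fdst e = v) : e ∈ p.F := by
  rw [mem_pre] at hvK
  obtain ⟨w', hw', h1, h2, h3⟩ := hg _ hvK.2
  have : w' = v := hv.2.2.2.1 hw' hvK.1 h1
  subst this
  exact h2 e he h

lemma good_lift (hv : p.Valid G) {K : Finset V} (hg : ∀ u ∈ K, p.GoodAt G u) {e : E} (he : G.src e ∈ K) :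
    ∃ e' ∈ p.F, p.φE e' = e ∧ p.H.fsrc e' ∈ pre p K := by
  obtain ⟨w', hw', h1, h2, h3⟩ := hg _ he
  obtain ⟨e', ⟨h4, h5, h6⟩, _⟩ := h3 e (Or.inl rfl)
  have := hv.2.2.2.2.2 e' h4
  refine ⟨e', h4, h6, (mem_pre _ _ _).2 ⟨this.1, ?_⟩⟩
  rw [← this.2.2.1, h6]; exact he

lemma good_pre (hv : p.Valid G) {K : Finset V} (hg : ∀ u ∈ K, p.GoodAt G u) {v : V} (h : v ∈ K) :
    ∃ v' ∈ pre p K, p.φV v' = v := by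
  obtain ⟨w', hw', h1, h2, h3⟩ := hg _ h
  exact ⟨w', (mem_pre _ _ _).2 ⟨hw', h1 ▸ h⟩, h1⟩

lemma swap_arb (hv : p.Valid G) {K : Finset V} (hg : ∀ u ∈ K, p.GoodAt G u)
    (hz : p.z ∉ pre p K) {B : Finset ℕ} {C : Set E} (hB : p.H.IsArb p.z B) (hC : IsWiredArb G K C)
    (hc : Clo p K B) : p.H.IsArb p.z (swB p K B C) := by
  obtain ⟨hA, hF, hzV, hiV, hiE, hinc⟩ := id hv
  have hout : ∀ v ∈ p.H.VS, v ∉ pre p K → Relation.ReflTransGen (fstep p (swB p K B C)) v p.z := by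
    intro v h1 h2
    exact (path_out p hc (fun e he h => (mem_swB _ _ _ _ _).2 (Or.inl ⟨he, h⟩)) (hB.2.2.2 v h1) h2).1
  refine ⟨?_, ?_, ?_, ?_⟩
  · intro e he
    rcases (mem_swB _ _ _ _ _).1 he with ⟨h, _⟩ | ⟨h, _⟩
    · exact hB.1 h
    · exact hF h
  · intro e he
    rcases (mem_swB _ _ _ _ _).1 he with ⟨h, _⟩ | ⟨h, h2, _⟩
    · exact hB.2.1 e h
    · intro h3; exact hz (h3 ▸ h2)
  · intro v hvS hvz
    by_cases hvK : v ∈ pre p K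
    · obtain ⟨e, ⟨he1, he2⟩, _⟩ := hC.2.1 _ ((mem_pre _ _ _).1 hvK).2
      obtain ⟨e', h1, h2, h3⟩ := good_lift G p hv hg (e := e) (hC.1 e he1)
      have h4 : p.H.fsrc e' = v := by
        apply hiV (hinc e' h1).1 ((mem_pre _ _ _).1 hvK).1
        rw [← (hinc e' h1).2.2.1, h2, he2]
      refine ⟨e', ⟨(mem_swB _ _ _ _ _).2 (Or.inr ⟨h1, h3, h2 ▸ he1⟩), h4⟩, ?_⟩
      rintro e2 ⟨h5, h6⟩
      rcases (mem_swB _ _ _ _ _).1 h5 with ⟨_, h7⟩ | ⟨h7, h8, h9⟩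
      · exact absurd (h6 ▸ hvK) h7
      · apply hiE h7 h1
        refine (hC.2.1 _ ((mem_pre _ _ _).1 hvK).2).unique ⟨h9, ?_⟩ ⟨h2 ▸ he1, ?_⟩
        · rw [(hinc e2 h7).2.2.1, h6]
        · rw [(hinc e' h1).2.2.1, h4]
    · obtain ⟨e, ⟨he1, he2⟩, he3⟩ := hB.2.2.1 v hvS hvz
      refine ⟨e, ⟨(mem_swB _ _ _ _ _).2 (Or.inl ⟨he1, he2 ▸ hvK⟩), he2⟩, ?_⟩
      rintro e2 ⟨h5, h6⟩
      rcases (mem_swB _ _ _ _ _).1 h5 with ⟨h7, _⟩ | ⟨_, h8, _⟩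
      · exact he3 e2 ⟨h7, h6⟩
      · exact absurd (h6 ▸ h8) hvK
  · intro v hvS
    change Relation.ReflTransGen (fstep p (swB p K B C)) v p.z
    by_cases hvK : v ∈ pre p K
    · obtain ⟨y, hy, hp⟩ := hC.2.2 _ ((mem_pre _ _ _).1 hvK).2
      have : ∃ w ∈ p.A, p.φV w = y ∧ Relation.ReflTransGen (fstep p (swB p K B C)) v w := by
        clear hy
        induction hp with
        | refl => exact ⟨v, ((mem_pre _ _ _).1 hvK).1, rfl, Relation.ReflTransGen.refl⟩
        | tail _ hs ih =>
          obtain ⟨w, hw, hw2, hw3⟩ := ih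
          obtain ⟨e, he, h1, h2⟩ := hs
          obtain ⟨e', h4, h5, h6⟩ := good_lift G p hv hg (e := e) (hC.1 e he)
          have h7 := hinc e' h4
          refine ⟨p.H.fdst e', h7.2.1, ?_, hw3.tail ⟨e', (mem_swB _ _ _ _ _).2 (Or.inr ⟨h4, h6, h5 ▸ he⟩), ?_, rfl⟩⟩
          · rw [← h7.2.2.2, h5, h2]
          · apply hiV h7.1 hw
            rw [← h7.2.2.1, h5, h1, hw2]
      obtain ⟨w, hw, hw2, hw3⟩ := this
      refine hw3.trans (hout w (hA hw) fun h => hy ?_)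
      rw [← hw2]; exact ((mem_pre _ _ _).1 h).2
    · exact hout v hvS hvK

lemma swap_clo (hv : p.Valid G) {K : Finset V} {B : Finset ℕ} (C : Set E)
    (hc : Clo p K B) : Clo p K (swB p K B C) := by
  intro e he hd
  rcases (mem_swB _ _ _ _ _).1 he with ⟨h, h'⟩ | ⟨h, h2, _⟩
  · exact absurd (hc e h hd) h'
  · exact h2

lemma swap_Kst (hv : p.Valid G) {K U : Finset V} (hKU : K ⊆ U) {B : Finset ℕ} (C : Set E)
    (h : Kst p U B = pre p K) : Kst p U (swB p K B C) = pre p K := by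
  have hc := clo_of_Kst p h
  have hc' := swap_clo G p hv C hc
  have hsub : pre p K ⊆ pre p U := fun v hv => by
    rw [mem_pre] at hv ⊢; exact ⟨hv.1, hKU hv.2⟩
  ext v
  constructor
  · intro hv1
    by_contra hvK
    have hv2 : v ∉ Kst p U B := h ▸ hvK
    rw [mem_Kst] at hv1 hv2
    push Not at hv2
    obtain ⟨u, hu, hu'⟩ := hv2 hv1.1
    have hu2 : u ∉ pre p K := fun h => hu' (hsub h)
    exact hu' (hv1.2 u (path_out p hc (fun e he h => (mem_swB _ _ _ _ _).2 (Or.inl ⟨he, h⟩)) hu hu2).1)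
  · intro hvK
    rw [mem_Kst]
    exact ⟨hsub hvK, fun u hu => hsub (path_in p hc' hu hvK)⟩

lemma swap_wired (hv : p.Valid G) {K : Finset V} (hg : ∀ u ∈ K, p.GoodAt G u)
    (hz : p.z ∉ pre p K) {B : Finset ℕ} (hB : p.H.IsArb p.z B) :
    IsWiredArb G K (swC G p K B) := by
  obtain ⟨hA, hF, hzV, hiV, hiE, hinc⟩ := id hv
  have hin : ∀ e ∈ B, p.H.fsrc e ∈ pre p K → e ∈ p.F ∧ p.φE e ∈ swC G p K B := by
    intro e he h
    have h1 := good_in G p hv hg h (hB.1 he) (Or.inl rfl)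
    refine ⟨h1, ⟨e, he, h1, rfl⟩, ?_⟩
    rw [(hinc e h1).2.2.1]; exact ((mem_pre _ _ _).1 h).2
  refine ⟨fun e he => he.2, ?_, ?_⟩
  · intro v hvK
    obtain ⟨v', h1, rfl⟩ := good_pre G p hv hg hvK
    have h1' := ((mem_pre _ _ _).1 h1).1
    obtain ⟨e, ⟨he1, he2⟩, he3⟩ := hB.2.2.1 v' (hA h1') (fun h => hz (h ▸ h1))
    have h2 := hin e he1 (he2 ▸ h1)
    refine ⟨p.φE e, ⟨h2.2, ?_⟩, ?_⟩
    · rw [(hinc e h2.1).2.2.1, he2]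
    · rintro _ ⟨⟨⟨e2, h3, h4, rfl⟩, _⟩, h6⟩
      rw [he3 e2 ⟨h3, ?_⟩]
      apply hiV (hinc e2 h4).1 h1'
      rw [← (hinc e2 h4).2.2.1, h6]
  · intro v hvK
    obtain ⟨v', h1, rfl⟩ := good_pre G p hv hg hvK
    have hp := hB.2.2.2 v' (hA ((mem_pre _ _ _).1 h1).1)
    induction hp using Relation.ReflTransGen.head_induction_on with
    | refl => exact absurd h1 hz
    | @head a b hs _ ih =>
      obtain ⟨e, he, h2, h3⟩ := hs
      have h4 := hin e he (h2 ▸ h1)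
      have h5 := hinc e h4.1
      have hst : G.step (swC G p K B) (p.φV a) (p.φV b) :=
        ⟨p.φE e, h4.2, by rw [h5.2.2.1, h2], by rw [h5.2.2.2, h3]⟩
      by_cases hb : p.φV b ∈ K
      · obtain ⟨y, hy, hy2⟩ := ih ((mem_pre _ _ _).2 ⟨h3 ▸ h5.2.1, hb⟩) hb
        exact ⟨y, hy, hy2.head hst⟩
      · exact ⟨_, hb, Relation.ReflTransGen.single hst⟩

lemma swap_swapB (hv : p.Valid G) {K : Finset V} (hg : ∀ u ∈ K, p.GoodAt G u) {B : Finset ℕ} (C : Set E)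
    (hB : p.H.IsArb p.z B) : swB p K (swB p K B C) (swC G p K B) = B := by
  obtain ⟨hA, hF, hzV, hiV, hiE, hinc⟩ := id hv
  ext e
  rw [mem_swB, mem_swB]
  constructor
  · rintro (⟨⟨h, _⟩ | ⟨_, h, _⟩, h2⟩ | ⟨h1, h2, ⟨e2, h3, h4, h5⟩, _⟩)
    · exact h
    · exact absurd h h2
    · rwa [← hiE h4 h1 h5]
  · intro he
    by_cases h : p.H.fsrc e ∈ pre p K
    · have h1 := good_in G p hv hg h (hB.1 he) (Or.inl rfl)
      refine Or.inr ⟨h1, h, ⟨e, he, h1, rfl⟩, ?_⟩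
      rw [(hinc e h1).2.2.1]; exact ((mem_pre _ _ _).1 h).2
    · exact Or.inl ⟨Or.inl ⟨he, h⟩, h⟩

lemma swap_swapC (hv : p.Valid G) {K : Finset V} (hg : ∀ u ∈ K, p.GoodAt G u) (B : Finset ℕ) {C : Set E}
    (hC : ∀ e ∈ C, G.src e ∈ K) : swC G p K (swB p K B C) = C := by
  obtain ⟨hA, hF, hzV, hiV, hiE, hinc⟩ := id hv
  ext e
  constructor
  · rintro ⟨⟨e', h1, h2, rfl⟩, h3⟩
    rcases (mem_swB _ _ _ _ _).1 h1 with ⟨_, h4⟩ | ⟨_, _, h4⟩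
    · rw [(hinc e' h2).2.2.1] at h3
      exact absurd ((mem_pre _ _ _).2 ⟨(hinc e' h2).1, h3⟩) h4
    · exact h4
  · intro he
    obtain ⟨e', h1, h2, h3⟩ := good_lift G p hv hg (hC e he)
    exact ⟨⟨e', (mem_swB _ _ _ _ _).2 (Or.inr ⟨h1, h3, h2 ▸ he⟩), h1, h2⟩, hC e he⟩

open Classical in
lemma swap_card (hv : p.Valid G) {K U : Finset V} (hKU : K ⊆ U) (hg : ∀ u ∈ U, p.GoodAt G u)
    (hz : ¬ (p.z ∈ p.A ∧ p.φV p.z ∈ (U : Set V))) (F : Finset E)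
    (hN : Nat.card {C : Set E // IsWiredArb G K C} ≠ 0) :
    ((arbs p).filter (fun B => Kst p U B = pre p K)).card *
        Nat.card {C : Set E // IsWiredArb G K C ∧ (F : Set E) ⊆ C} ≤
      ((arbs p).filter (fun B => Kst p U B = pre p K ∧ (F : Set E) ⊆ imE p B)).card *
        Nat.card {C : Set E // IsWiredArb G K C} := by
  have hg' : ∀ u ∈ K, p.GoodAt G u := fun u hu => hg u (hKU hu)
  have hz' : p.z ∉ pre p K := fun h => hz ⟨((mem_pre _ _ _).1 h).1, hKU ((mem_pre _ _ _).1 h).2⟩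
  have : Finite {C : Set E // IsWiredArb G K C} := Nat.finite_of_card_ne_zero hN
  rw [← Nat.card_eq_finsetCard, ← Nat.card_eq_finsetCard, ← Nat.card_prod, ← Nat.card_prod]
  have hm1 : ∀ B, B ∈ (arbs p).filter (fun B => Kst p U B = pre p K) ↔ p.H.IsArb p.z B ∧ Kst p U B = pre p K := by
    intro B; rw [Finset.mem_filter, mem_arbs]
  have hm2 : ∀ B, B ∈ (arbs p).filter (fun B => Kst p U B = pre p K ∧ (F : Set E) ⊆ imE p B) ↔
      p.H.IsArb p.z B ∧ Kst p U B = pre p K ∧ (F : Set E) ⊆ imE p B := by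
    intro B; rw [Finset.mem_filter, mem_arbs]
  have ha : ∀ x : ((arbs p).filter (fun B => Kst p U B = pre p K)) ×
      {C : Set E // IsWiredArb G K C ∧ (F : Set E) ⊆ C}, swB p K x.1.1 x.2.1 ∈
      (arbs p).filter (fun B => Kst p U B = pre p K ∧ (F : Set E) ⊆ imE p B) := by
    rintro ⟨⟨B, hB⟩, ⟨C, hC, hFC⟩⟩
    rw [hm1] at hB
    rw [hm2]
    refine ⟨swap_arb G p hv hg' hz' hB.1 hC (clo_of_Kst p hB.2), swap_Kst G p hv hKU C hB.2, ?_⟩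
    intro e he
    have := hFC he
    rw [← swap_swapC G p hv hg' B hC.1] at this
    exact this.1
  have hb : ∀ x : ((arbs p).filter (fun B => Kst p U B = pre p K)) ×
      {C : Set E // IsWiredArb G K C ∧ (F : Set E) ⊆ C}, IsWiredArb G K (swC G p K x.1.1) := by
    rintro ⟨⟨B, hB⟩, ⟨C, hC, hFC⟩⟩
    rw [hm1] at hB
    exact swap_wired G p hv hg' hz' hB.1
  refine Nat.card_le_card_of_injective
    (fun x => ((⟨swB p K x.1.1 x.2.1, ha x⟩, ⟨swC G p K x.1.1, hb x⟩) : _ × _)) ?_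
  · rintro ⟨⟨B, hB⟩, ⟨C, hC, hFC⟩⟩ ⟨⟨B2, hB2⟩, ⟨C2, hC2, hFC2⟩⟩ h
    rw [hm1] at hB hB2
    simp only [Prod.mk.injEq, Subtype.mk.injEq] at h ⊢
    constructor
    · rw [← swap_swapB G p hv hg' C hB.1, ← swap_swapB G p hv hg' C2 hB2.1, h.1, h.2]
    · rw [← swap_swapC G p hv hg' B hC.1, ← swap_swapC G p hv hg' B2 hC2.1, h.1]

open Classical in
noncomputable def Kim (U : Finset V) (B : Finset ℕ) : Finset V := (Kst p U B).image p.φV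

lemma Kim_sub (U : Finset V) (B : Finset ℕ) : Kim p U B ⊆ U := by
  classical
  intro v h
  obtain ⟨w, hw, rfl⟩ := Finset.mem_image.1 h
  exact ((mem_pre _ _ _).1 ((mem_Kst _ _ _ _).1 hw).1).2

lemma Kst_eq_pre (hv : p.Valid G) (U : Finset V) (B : Finset ℕ) : Kst p U B = pre p (Kim p U B) := by
  classical
  ext v
  rw [mem_pre]
  constructor
  · intro h
    exact ⟨((mem_pre _ _ _).1 ((mem_Kst _ _ _ _).1 h).1).1, Finset.mem_image_of_mem _ h⟩
  · rintro ⟨h1, h2⟩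
    obtain ⟨w, hw, h3⟩ := Finset.mem_image.1 h2
    rwa [← hv.2.2.2.1 ((mem_pre _ _ _).1 ((mem_Kst _ _ _ _).1 hw).1).1 h1 h3]

open Classical in
lemma swap_main (hv : p.Valid G) {U0 U : Finset V} (hg : ∀ u ∈ U, p.GoodAt G u)
    (hz : ¬ (p.z ∈ p.A ∧ p.φV p.z ∈ (U : Set V))) (F : Finset E)
    (hN : ∀ K : Finset V, Nat.card {C : Set E // IsWiredArb G K C} ≠ 0) (κ : ℝ≥0∞)
    (hκ : ∀ K : Finset V, U0 ⊆ K → κ ≤ wiredUACyl G K F) :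
    κ * (((arbs p).filter (fun B => U0 ⊆ Kim p U B)).card : ℝ≥0∞) ≤
      (((arbs p).filter (fun B => (F : Set E) ⊆ imE p B)).card : ℝ≥0∞) := by
  have key : ∀ K ∈ U.powerset.filter (fun K => U0 ⊆ K),
      κ * (((arbs p).filter (fun B => Kst p U B = pre p K)).card : ℝ≥0∞) ≤
      (((arbs p).filter (fun B => Kst p U B = pre p K ∧ (F : Set E) ⊆ imE p B)).card : ℝ≥0∞) := by
    intro K hK
    rw [Finset.mem_filter, Finset.mem_powerset] at hK
    have h1 := swap_card G p hv hK.1 hg hz F (hN K)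
    have h2 := hκ K hK.2
    have h0 : (Nat.card {C : Set E // IsWiredArb G K C} : ℝ≥0∞) ≠ 0 := by exact_mod_cast hN K
    rw [wiredUACyl, ENNReal.le_div_iff_mul_le (Or.inl h0) (Or.inl (by simp))] at h2
    rw [← ENNReal.mul_le_mul_iff_left h0 (by simp)]
    calc _ = (((arbs p).filter (fun B => Kst p U B = pre p K)).card : ℝ≥0∞) *
          (κ * Nat.card {C : Set E // IsWiredArb G K C}) := by ring
      _ ≤ _ := mul_le_mul_right h2 _
      _ ≤ _ := by exact_mod_cast h1
  have hiff : ∀ K ⊆ U, ∀ B, Kst p U B = pre p K ↔ Kim p U B = K := by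
    intro K hK B
    constructor
    · intro h
      rw [Kim, h]
      ext v
      rw [Finset.mem_image]
      constructor
      · rintro ⟨w, hw, rfl⟩; exact ((mem_pre _ _ _).1 hw).2
      · intro h; exact good_pre G p hv (fun u hu => hg u (hK hu)) h
    · rintro rfl; exact Kst_eq_pre G p hv U B
  have hsum : ∀ P : Finset ℕ → Prop, ((arbs p).filter (fun B => U0 ⊆ Kim p U B ∧ P B)).card =
      ∑ K ∈ U.powerset.filter (fun K => U0 ⊆ K), ((arbs p).filter (fun B => Kst p U B = pre p K ∧ P B)).card := by
    intro P
    rw [Finset.card_eq_sum_card_fiberwise (f := fun B => Kim p U B) (t := U.powerset.filter (fun K => U0 ⊆ K))]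
    · refine Finset.sum_congr rfl fun K hK => ?_
      rw [Finset.mem_filter, Finset.mem_powerset] at hK
      congr 1
      ext B
      simp only [Finset.mem_filter, hiff K hK.1]
      constructor
      · rintro ⟨⟨a, b, c⟩, d⟩; exact ⟨a, d, c⟩
      · rintro ⟨a, rfl, c⟩; exact ⟨⟨a, hK.2, c⟩, rfl⟩
    · intro B hB
      have hB := Finset.mem_coe.1 hB
      rw [Finset.mem_filter] at hB
      exact Finset.mem_coe.2 (Finset.mem_filter.2 ⟨Finset.mem_powerset.2 (Kim_sub p U B), hB.2.1⟩)
  have e1 := hsum (fun _ => True)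
  have e2 := hsum (fun B => (F : Set E) ⊆ imE p B)
  simp only [and_true] at e1
  rw [e1, Nat.cast_sum, Finset.mul_sum]
  calc _ ≤ _ := Finset.sum_le_sum key
    _ = _ := by rw [← Nat.cast_sum, ← e2]
    _ ≤ _ := by
      apply Nat.cast_le.2
      apply Finset.card_le_card
      intro B hB
      rw [Finset.mem_filter] at hB ⊢
      exact ⟨hB.1, hB.2.2⟩

end Swap

section Choice
variable {V E : Type} (G : DigraphStruct V E) (hlf : G.LocallyFinite)

open Classical in
/-- The finite set of choices of one outgoing edge for each vertex in `W`. -/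
noncomputable def Ch (W : Finset V) : Finset (Finset E) :=
  (W.biUnion (outF G hlf)).powerset.filter fun c => ∀ w ∈ W, ∃! e, e ∈ c ∧ G.src e = w

lemma mem_Ch (W : Finset V) (c : Finset E) : c ∈ Ch G hlf W ↔
    (∀ e ∈ c, G.src e ∈ W) ∧ ∀ w ∈ W, ∃! e, e ∈ c ∧ G.src e = w := by
  classical
  simp only [Ch, Finset.mem_filter, Finset.mem_powerset]
  refine and_congr_left fun _ => ?_
  constructor
  · intro h e he
    obtain ⟨w, hw, h2⟩ := Finset.mem_biUnion.1 (h he)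
    rw [mem_outF] at h2
    exact h2 ▸ hw
  · intro h e he
    exact Finset.mem_biUnion.2 ⟨_, h e he, (mem_outF _ _ _ _).2 rfl⟩

lemma imE_unique (p : PIso V E) (hv : p.Valid G) {B : Finset ℕ} (hB : p.H.IsArb p.z B) {e e2 : E}
    (he : e ∈ imE p B) (he2 : e2 ∈ imE p B) (h : G.src e = G.src e2) : e = e2 := by
  obtain ⟨hA, hF, hzV, hiV, hiE, hinc⟩ := id hv
  obtain ⟨a, h1, h2, rfl⟩ := he
  obtain ⟨b, h3, h4, rfl⟩ := he2
  have h5 := hinc a h2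
  have h6 := hinc b h4
  rw [h5.2.2.1, h6.2.2.1] at h
  have h7 := hiV h5.1 h6.1 h
  rw [(hB.2.2.1 _ (hA h5.1) (hB.2.1 a h1)).unique ⟨h1, rfl⟩ ⟨h3, h7.symm⟩]

lemma choice_unique {S : Set E} (hS : ∀ e ∈ S, ∀ e2 ∈ S, G.src e = G.src e2 → e = e2)
    {W : Finset V} {c c2 : Finset E} (hc : c ∈ Ch G hlf W) (hc2 : c2 ∈ Ch G hlf W)
    (h : (c : Set E) ⊆ S) (h2 : (c2 : Set E) ⊆ S) : c = c2 := by
  rw [mem_Ch] at hc hc2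
  have : ∀ c c2 : Finset E, (∀ e ∈ c, G.src e ∈ W) → (∀ w ∈ W, ∃! e, e ∈ c2 ∧ G.src e = w) →
      (c : Set E) ⊆ S → (c2 : Set E) ⊆ S → c ⊆ c2 := by
    intro c c2 hc hc2 h h2 e he
    obtain ⟨e2, ⟨h3, h4⟩, _⟩ := hc2 _ (hc e he)
    rwa [hS e (h he) e2 (h2 h3) h4.symm]
  exact Finset.Subset.antisymm (this c c2 hc.1 hc2.2 h h2) (this c2 c hc2.1 hc.2 h2 h)

open Classical in
lemma sum_piso_le (p : PIso V E) (hv : p.Valid G) (W : Finset V) (D : Finset (Finset E))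
    (hD : D ⊆ Ch G hlf W) (P : Finset ℕ → Prop)
    (hP : ∀ c ∈ D, ∀ B, p.H.IsArb p.z B → (c : Set E) ⊆ imE p B → P B) :
    ∑ c ∈ D, pisoUACyl p c ≤ (((arbs p).filter P).card : ℝ≥0∞) / ((arbs p).card : ℝ≥0∞) := by
  simp_rw [pisoUACyl_eq, div_eq_mul_inv]
  rw [← Finset.sum_mul]
  refine mul_le_mul_left ?_ _
  rw [← Nat.cast_sum, ← Finset.card_biUnion]
  · apply Nat.cast_le.2
    apply Finset.card_le_card
    intro B hB
    obtain ⟨c, hc, h⟩ := Finset.mem_biUnion.1 hB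
    rw [Finset.mem_filter] at h ⊢
    exact ⟨h.1, hP c hc B ((mem_arbs _ _).1 h.1) h.2⟩
  · intro c hc c2 hc2 hne
    apply Finset.disjoint_left.2
    intro B hB hB2
    rw [Finset.mem_filter] at hB hB2
    apply hne
    exact choice_unique G hlf (S := imE p B)
      (fun e he e2 he2 h => imE_unique G p hv ((mem_arbs _ _).1 hB.1) he he2 h) (hD hc) (hD hc2) hB.2 hB2.2

lemma sum_piso_le_one (p : PIso V E) (hv : p.Valid G) (W : Finset V) :
    ∑ c ∈ Ch G hlf W, pisoUACyl p c ≤ 1 := by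
  classical
  refine (sum_piso_le G hlf p hv W _ subset_rfl (fun _ => True) (by simp)).trans ?_
  simp only [Finset.filter_true]
  exact ENNReal.div_self_le_one

/-- choice good -/
def GoodC (U0 U : Finset V) (c : Set E) : Prop :=
  ∀ v ∈ U0, ∀ u, Relation.ReflTransGen (G.step c) u v → u ∈ U

lemma good_Kim (p : PIso V E) (hv : p.Valid G) {U0 U W : Finset V} (hg : ∀ u ∈ U, p.GoodAt G u)
    (hW : ∀ e, G.dst e ∈ U → G.src e ∈ W) {c : Finset E} (hc : c ∈ Ch G hlf W)
    (hgc : GoodC G U0 U (c : Set E)) {B : Finset ℕ} (hB : p.H.IsArb p.z B) (hcB : (c : Set E) ⊆ imE p B) :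
    U0 ⊆ Kim p U B := by
  classical
  obtain ⟨hA, hF, hzV, hiV, hiE, hinc⟩ := id hv
  rw [mem_Ch] at hc
  intro v hv0
  obtain ⟨v', h1, h2⟩ := good_pre G p hv hg (hgc v hv0 v Relation.ReflTransGen.refl)
  refine Finset.mem_image.2 ⟨v', (mem_Kst _ _ _ _).2 ⟨h1, fun u hu => ?_⟩, h2⟩
  suffices h : u ∈ p.A ∧ Relation.ReflTransGen (G.step (c : Set E)) (p.φV u) v from
    (mem_pre _ _ _).2 ⟨h.1, hgc v hv0 _ h.2⟩
  induction hu using Relation.ReflTransGen.head_induction_on with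
  | refl => exact ⟨((mem_pre _ _ _).1 h1).1, h2 ▸ Relation.ReflTransGen.refl⟩
  | @head a b hs _ ih =>
    obtain ⟨e', he, h3, h4⟩ := hs
    have hbU := hgc v hv0 _ ih.2
    have hb : b ∈ pre p U := (mem_pre _ _ _).2 ⟨ih.1, hbU⟩
    have h5 := good_in G p hv hg hb (hB.1 he) (Or.inr h4)
    have h6 := hinc e' h5
    have h7 : G.dst (p.φE e') = p.φV b := by rw [h6.2.2.2, h4]
    have h8 : G.src (p.φE e') = p.φV a := by rw [h6.2.2.1, h3]
    refine ⟨h3 ▸ h6.1, ih.2.head ⟨p.φE e', ?_, h8, h7⟩⟩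
    obtain ⟨e2, ⟨h9, h10⟩, _⟩ := hc.2 _ (hW (p.φE e') (h7 ▸ hbU))
    rwa [imE_unique G p hv hB ⟨e', he, h5, rfl⟩ (hcB h9) h10.symm]

open Classical in
theorem piso_bound (p : PIso V E) (hv : p.Valid G) {U0 U W : Finset V} (hg : ∀ u ∈ U, p.GoodAt G u)
    (hz : ¬ (p.z ∈ p.A ∧ p.φV p.z ∈ (U : Set V)))
    (hW : ∀ e, G.dst e ∈ U → G.src e ∈ W) (F : Finset E)
    (hN : ∀ K : Finset V, Nat.card {C : Set E // IsWiredArb G K C} ≠ 0) (κ : ℝ≥0∞)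
    (hκ : ∀ K : Finset V, U0 ⊆ K → κ ≤ wiredUACyl G K F) :
    κ * ∑ c ∈ (Ch G hlf W).filter (fun c : Finset E => GoodC G U0 U (c : Set E)), pisoUACyl p c ≤ pisoUACyl p F := by
  have h1 := sum_piso_le G hlf p hv W ((Ch G hlf W).filter (fun c : Finset E => GoodC G U0 U (c : Set E)))
    (Finset.filter_subset _ _) (fun B => U0 ⊆ Kim p U B) (by
      intro c hc B hB hcB
      rw [Finset.mem_filter] at hc
      exact good_Kim G hlf p hv hg hW hc.1 hc.2 hB hcB)
  refine (mul_le_mul_right h1 κ).trans ?_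
  rw [pisoUACyl_eq, ← mul_div_assoc]
  have h2 := ENNReal.div_le_div_right (swap_main G p hv hg hz F hN κ hκ) ((arbs p).card : ℝ≥0∞)
  refine le_trans (le_of_eq ?_) h2
  congr!

end Choice

section Limit
variable {V E : Type} (G : DigraphStruct V E)

def cylE (F : Finset E) : Set (E → Bool) := {A | ∀ e ∈ F, A e = true}

def OneE : Set (E → Bool) := {A | IsOneEndedSpanningArb G {e : E | A e = true}}

lemma cylE_meas (F : Finset E) : MeasurableSet (cylE F) := by
  have : cylE F = ⋂ e ∈ F, (fun A : E → Bool => A e) ⁻¹' {true} := by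
    ext A; simp [cylE]
  rw [this]
  exact Finset.measurableSet_biInter _ fun e _ => measurable_pi_apply e (measurableSet_singleton _)

lemma restrict_Ch (hlf : G.LocallyFinite) (W : Finset V) (A : Set E)
    (hA : ∀ v ∈ W, ∃! e : E, e ∈ A ∧ G.src e = v) :
    ∃ c ∈ Ch G hlf W, (c : Set E) ⊆ A := by
  classical
  refine ⟨(W.biUnion (outF G hlf)).filter (· ∈ A), ?_, ?_⟩
  · rw [mem_Ch]
    have hm : ∀ e, e ∈ (W.biUnion (outF G hlf)).filter (· ∈ A) ↔ G.src e ∈ W ∧ e ∈ A := by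
      intro e
      simp [mem_outF]
    refine ⟨fun e he => ((hm e).1 he).1, fun w hw => ?_⟩
    obtain ⟨e, ⟨h1, h2⟩, h3⟩ := hA w hw
    exact ⟨e, ⟨(hm e).2 ⟨h2 ▸ hw, h1⟩, h2⟩, fun e2 h => h3 e2 ⟨((hm e2).1 h.1).2, h.2⟩⟩
  · intro e he
    exact (Finset.mem_filter.1 (Finset.mem_coe.1 he)).2

variable (hlf : G.LocallyFinite) (μ : Measure (E → Bool))

lemma one_le_sum (hO : μ (OneE G) = 1) (W : Finset V) : 1 ≤ ∑ c ∈ Ch G hlf W, μ (cylE c) := by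
  rw [← hO]
  refine (measure_mono ?_).trans (measure_biUnion_finset_le _ _)
  intro A hA
  obtain ⟨c, hc, h⟩ := restrict_Ch G hlf W _ (fun v _ => hA.1 v)
  exact mem_biUnion hc (fun e he => h he)

open Classical in
lemma good_le_sum (U0 U W : Finset V) :
    μ (OneE G ∩ {A | GoodC G U0 U {e | A e = true}}) ≤
      ∑ c ∈ (Ch G hlf W).filter (fun c : Finset E => GoodC G U0 U (c : Set E)), μ (cylE c) := by
  refine (measure_mono ?_).trans (measure_biUnion_finset_le _ _)
  rintro A ⟨hA, hgA⟩
  obtain ⟨c, hc, h⟩ := restrict_Ch G hlf W _ (fun v _ => hA.1 v)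
  refine mem_biUnion (x := c) (Finset.mem_filter.2 ⟨hc, ?_⟩) (fun e he => h he)
  intro v hv u hu
  refine hgA v hv u (Relation.ReflTransGen.mono ?_ _ _ hu)
  rintro a b ⟨e, he, h1⟩
  exact ⟨e, h he, h1⟩

section Integ
variable {Ω : Type} [MeasurableSpace Ω] (ν : Measure Ω) (a : Ω → ℕ → PIso V E)

open Classical in
theorem limit_bound [Countable V] (hν : ν univ = 1) (ha : ∀ ω, IsFinApproxSeq G (a ω))
    (hlim : ∀ F : Finset E, Tendsto (fun n => ∫⁻ ω, pisoUACyl (a ω n) F ∂ν) atTop (nhds (μ (cylE F))))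
    (hO : μ (OneE G) = 1) (W0 U0 U W : Finset V)
    (hW : ∀ e, G.dst e ∈ U → G.src e ∈ W) (F : Finset E) (hF : F ∈ Ch G hlf W0)
    (hN : ∀ K : Finset V, Nat.card {C : Set E // IsWiredArb G K C} ≠ 0) (κ : ℝ≥0∞) (hκt : κ ≠ ⊤)
    (hκ : ∀ K : Finset V, U0 ⊆ K → κ ≤ wiredUACyl G K F) :
    κ * ∑ c ∈ (Ch G hlf W).filter (fun c : Finset E => GoodC G U0 U (c : Set E)), μ (cylE c) ≤ μ (cylE F) := by
  have : IsProbabilityMeasure ν := ⟨hν⟩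
  have hex : ∀ (c : Finset E) (n : ℕ), ∃ g : Ω → ℝ≥0∞, Measurable g ∧
      g ≤ (fun ω => pisoUACyl (a ω n) c) ∧ ∫⁻ ω, pisoUACyl (a ω n) c ∂ν = ∫⁻ ω, g ω ∂ν := fun c n =>
    exists_measurable_le_lintegral_eq ν _
  choose g hgm hgle hgint using hex
  set D := (Ch G hlf W).filter (fun c : Finset E => GoodC G U0 U (c : Set E)) with hD
  have hle1 : ∀ W' : Finset V, ∀ n ω, ∑ c ∈ Ch G hlf W', g c n ω ≤ 1 := fun W' n ω =>
    (Finset.sum_le_sum fun c _ => hgle c n ω).trans (sum_piso_le_one G hlf (a ω n) ((ha ω).1 n) W')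
  let S : ℕ → Ω → ℝ≥0∞ := fun n ω => κ * ∑ c ∈ D, g c n ω
  let R : ℕ → Ω → ℝ≥0∞ := fun n ω => 1 - ∑ c ∈ Ch G hlf W0, g c n ω
  have hSm : ∀ n, Measurable (S n) := fun n =>
    (Finset.measurable_sum _ fun c _ => hgm c n).const_mul _
  have hRm : ∀ n, Measurable (R n) := fun n =>
    measurable_const.sub (Finset.measurable_sum _ fun c _ => hgm c n)
  have hSle : ∀ n ω, S n ω ≤ κ := fun n ω => by
    calc κ * ∑ c ∈ D, g c n ω ≤ κ * 1 := by
          gcongr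
          exact (Finset.sum_le_sum_of_subset (Finset.filter_subset _ _)).trans (hle1 W n ω)
      _ = κ := mul_one _
  have hfR : ∀ n ω, pisoUACyl (a ω n) F ≤ g F n ω + R n ω := by
    intro n ω
    have h1 := sum_piso_le_one G hlf (a ω n) ((ha ω).1 n) W0
    rw [← Finset.add_sum_erase _ _ hF] at h1
    have h2 : pisoUACyl (a ω n) F + ∑ c ∈ (Ch G hlf W0).erase F, g c n ω ≤ 1 :=
      le_trans (by gcongr with c hc; exact hgle c n ω) h1
    have h3 : ∑ c ∈ (Ch G hlf W0).erase F, g c n ω ≠ ⊤ :=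
      ne_top_of_le_ne_top ENNReal.one_ne_top (le_trans le_add_self h2)
    have h4 : (1 : ℝ≥0∞) ≤ (g F n ω + R n ω) + ∑ c ∈ (Ch G hlf W0).erase F, g c n ω := by
      have h5 : 1 ≤ (∑ c ∈ Ch G hlf W0, g c n ω) + R n ω := le_add_tsub
      rw [← Finset.add_sum_erase _ _ hF] at h5
      calc 1 ≤ _ := h5
        _ = _ := by ring
    exact (ENNReal.add_le_add_iff_right h3).1 (h2.trans h4)
  have hev : ∀ ω, ∀ᶠ n in atTop, S n ω ≤ g F n ω + R n ω := by
    intro ω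
    obtain ⟨h1, h2, h3⟩ := ha ω
    obtain ⟨N1, hN1⟩ := h2 U
    obtain ⟨N2, hN2⟩ := h3 U
    filter_upwards [eventually_ge_atTop N1, eventually_ge_atTop N2] with n hn1 hn2
    refine le_trans ?_ (hfR n ω)
    refine le_trans ?_ (piso_bound G hlf (a ω n) (h1 n) (hN1 n hn1) (hN2 n hn2) hW F hN κ hκ)
    exact mul_le_mul_right (Finset.sum_le_sum fun c _ => hgle c n ω) _
  have hT : Tendsto (fun n => ∫⁻ ω, (S n ω - (g F n ω + R n ω)) ∂ν) atTop (nhds 0) := by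
    have := tendsto_lintegral_of_dominated_convergence (μ := ν)
      (F := fun n ω => S n ω - (g F n ω + R n ω)) (f := fun _ => 0) (fun _ => κ)
      (fun n => (hSm n).sub ((hgm F n).add (hRm n)))
      (fun n => Eventually.of_forall fun ω => tsub_le_self.trans (hSle n ω))
      (by simpa using hκt)
      (Eventually.of_forall fun ω => by
        refine tendsto_const_nhds.congr' ?_
        filter_upwards [hev ω] with n hn
        exact (tsub_eq_zero_of_le hn).symm)
    simpa using this
  have hgl : ∀ c, Tendsto (fun n => ∫⁻ ω, g c n ω ∂ν) atTop (nhds (μ (cylE c))) := by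
    intro c
    have := hlim c
    simpa only [hgint] using this
  have hRl : Tendsto (fun n => ∫⁻ ω, R n ω ∂ν) atTop (nhds 0) := by
    have h1 : ∀ n, ∫⁻ ω, R n ω ∂ν = 1 - ∑ c ∈ Ch G hlf W0, ∫⁻ ω, g c n ω ∂ν := by
      intro n
      have := lintegral_sub (μ := ν) (f := fun _ => (1:ℝ≥0∞)) (g := fun ω => ∑ c ∈ Ch G hlf W0, g c n ω)
        (Finset.measurable_sum _ fun c _ => hgm c n)
        (ne_top_of_le_ne_top (b := 1) ENNReal.one_ne_top (by
          calc _ ≤ ∫⁻ ω, 1 ∂ν := lintegral_mono fun ω => hle1 W0 n ω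
            _ = 1 := by simp)) (Eventually.of_forall fun ω => hle1 W0 n ω)
      rw [lintegral_finsetSum _ (fun c _ => hgm c n)] at this
      simpa using this
    simp_rw [h1]
    have h2 : Tendsto (fun n => 1 - ∑ c ∈ Ch G hlf W0, ∫⁻ ω, g c n ω ∂ν) atTop
        (nhds (1 - ∑ c ∈ Ch G hlf W0, μ (cylE c))) :=
      ENNReal.Tendsto.sub tendsto_const_nhds (tendsto_finsetSum _ fun c _ => hgl c)
        (Or.inl ENNReal.one_ne_top)
    rwa [tsub_eq_zero_of_le (one_le_sum G hlf μ hO W0)] at h2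
  have hSl : Tendsto (fun n => ∫⁻ ω, S n ω ∂ν) atTop (nhds (κ * ∑ c ∈ D, μ (cylE c))) := by
    have h1 : ∀ n, ∫⁻ ω, S n ω ∂ν = κ * ∑ c ∈ D, ∫⁻ ω, g c n ω ∂ν := by
      intro n
      rw [lintegral_const_mul _ (Finset.measurable_sum _ fun c _ => hgm c n),
        lintegral_finsetSum _ (fun c _ => hgm c n)]
    simp_rw [h1]
    exact ENNReal.Tendsto.const_mul (tendsto_finsetSum _ fun c _ => hgl c) (Or.inr hκt)
  have hfin : ∀ n, ∫⁻ ω, S n ω ∂ν ≤ (∫⁻ ω, g F n ω ∂ν + ∫⁻ ω, R n ω ∂ν) +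
      ∫⁻ ω, (S n ω - (g F n ω + R n ω)) ∂ν := by
    intro n
    rw [← lintegral_add_left (hgm F n), ← lintegral_add_left
      (show Measurable (fun ω => g F n ω + R n ω) from (hgm F n).add (hRm n))]
    exact lintegral_mono fun ω => le_add_tsub
  have := le_of_tendsto_of_tendsto' hSl (((hgl F).add hRl).add hT) hfin
  simpa using this

theorem sum_le_one' (hν : ν univ = 1) (ha : ∀ ω, IsFinApproxSeq G (a ω))
    (hlim : ∀ F : Finset E, Tendsto (fun n => ∫⁻ ω, pisoUACyl (a ω n) F ∂ν) atTop (nhds (μ (cylE F))))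
    (W : Finset V) : ∑ c ∈ Ch G hlf W, μ (cylE c) ≤ 1 := by
  have : IsProbabilityMeasure ν := ⟨hν⟩
  refine le_of_tendsto' (tendsto_finsetSum _ fun c _ => hlim c) fun n => ?_
  have hex : ∀ (c : Finset E), ∃ g : Ω → ℝ≥0∞, Measurable g ∧
      g ≤ (fun ω => pisoUACyl (a ω n) c) ∧ ∫⁻ ω, pisoUACyl (a ω n) c ∂ν = ∫⁻ ω, g ω ∂ν := fun c =>
    exists_measurable_le_lintegral_eq ν _
  choose g hgm hgle hgint using hex
  simp_rw [hgint]
  rw [← lintegral_finsetSum _ (fun c _ => hgm c)]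
  calc _ ≤ ∫⁻ ω, 1 ∂ν := lintegral_mono fun ω =>
        (Finset.sum_le_sum fun c _ => hgle c ω).trans (sum_piso_le_one G hlf (a ω n) ((ha ω).1 n) W)
    _ = 1 := by simp

end Integ

lemma wired_sum_ge (K W : Finset V) (hWK : W ⊆ K)
    (hN : Nat.card {C : Set E // IsWiredArb G K C} ≠ 0) :
    1 ≤ ∑ c ∈ Ch G hlf W, wiredUACyl G K c := by
  have hf : Finite {C : Set E // IsWiredArb G K C} := Nat.finite_of_card_ne_zero hN
  have hf2 : ∀ c : Finset E, Finite {C : Set E // IsWiredArb G K C ∧ (c : Set E) ⊆ C} := fun c =>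
    Finite.of_injective (fun C : {C : Set E // IsWiredArb G K C ∧ (c : Set E) ⊆ C} =>
      (⟨C.1, C.2.1⟩ : {C : Set E // IsWiredArb G K C})) (fun x y h => Subtype.ext (congrArg (fun z => z.1) h))
  have hr : ∀ C : {C : Set E // IsWiredArb G K C}, ∃ c ∈ Ch G hlf W, (c : Set E) ⊆ C.1 := fun C =>
    restrict_Ch G hlf W C.1 fun v hv => C.2.2.1 v (hWK hv)
  choose r hr1 hr2 using hr
  have h1 : Nat.card {C : Set E // IsWiredArb G K C} ≤
      ∑ c ∈ Ch G hlf W, Nat.card {C : Set E // IsWiredArb G K C ∧ (c : Set E) ⊆ C} := by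
    rw [← Finset.sum_coe_sort (Ch G hlf W)
      (fun c => Nat.card {C : Set E // IsWiredArb G K C ∧ (c : Set E) ⊆ C}), ← Nat.card_sigma]
    refine Nat.card_le_card_of_injective (fun C => ⟨⟨r C, hr1 C⟩, ⟨C.1, C.2, hr2 C⟩⟩) ?_
    intro C C' h
    have := congrArg (fun z : (Σ c : Ch G hlf W, {C : Set E // IsWiredArb G K C ∧ ((c : Finset E) : Set E) ⊆ C}) => z.2.1) h
    exact Subtype.ext this
  simp only [wiredUACyl, div_eq_mul_inv]
  rw [← Finset.sum_mul, ← div_eq_mul_inv, ENNReal.le_div_iff_mul_le (Or.inl (by exact_mod_cast hN)) (Or.inl (by simp)), one_mul]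
  exact_mod_cast h1

variable [Countable V] [MeasurableSpace V] [DiscreteMeasurableSpace V]

theorem main_tendsto (hlf : G.LocallyFinite) (htrans : G.TransientDigraph)
    (hμ : IsArbGibbs G μ) (hO : μ (OneE G) = 1) (F : Finset E) :
    Tendsto (fun K : Finset V => wiredUACyl G (K : Set V) F) atTop (nhds (μ (cylE F))) := by
  classical
  obtain ⟨hμ1, Ω, mΩ, ν, a, hν, ha, hlim⟩ := hμ
  have hprob : IsProbabilityMeasure μ := ⟨hμ1⟩
  have hd : ∀ v, G.outDeg v ≠ 0 := by
    have hne : (OneE G).Nonempty := by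
      apply nonempty_of_measure_ne_zero (μ := μ)
      rw [hO]; exact one_ne_zero
    obtain ⟨A, hA⟩ := hne
    intro v
    obtain ⟨e, ⟨_, he⟩, _⟩ := hA.1 v
    rw [← card_outF G hlf]
    exact Finset.card_ne_zero_of_mem ((mem_outF G hlf v e).2 he)
  have hN := card_wired_ne G hlf hd htrans
  choose L hL using wired_tendsto G hlf hd htrans
  by_cases hcons : ∀ e ∈ F, ∀ e2 ∈ F, G.src e = G.src e2 → e = e2
  · have hle : ∀ (W : Finset V), ∀ F ∈ Ch G hlf W, L F ≤ μ (cylE F) := by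
      intro W0 F hF
      refine le_of_forall_lt_imp_le_of_dense fun κ hκ => ?_
      have h1 : ∀ᶠ K : Finset V in atTop, κ < wiredUACyl G K F := (hL F).eventually_const_lt hκ
      obtain ⟨U0, hU0⟩ := eventually_atTop.1 h1
      have hκt : κ ≠ ⊤ := ne_top_of_lt hκ
      have h2 : ∀ U : Finset V, κ * μ (OneE G ∩ {A | GoodC G U0 U {e | A e = true}}) ≤ μ (cylE F) := by
        intro U
        let W : Finset V := U.biUnion fun u => (hlf u).2.toFinset.image G.src
        refine (mul_le_mul_right (good_le_sum G hlf μ U0 U W) κ).trans ?_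
        refine limit_bound G hlf μ ν a hν ha hlim hO W0 U0 U W ?_ F hF hN κ hκt (fun K hK => (hU0 K hK).le)
        intro e he
        refine Finset.mem_biUnion.2 ⟨_, he, Finset.mem_image.2 ⟨e, ?_, rfl⟩⟩
        simp [DigraphStruct.inEdges]
      have h3 : μ (OneE G) = ⨆ U : Finset V, μ (OneE G ∩ {A | GoodC G U0 U {e | A e = true}}) := by
        rw [← Directed.measure_iUnion]
        · congr 1
          ext A
          simp only [mem_iUnion, mem_inter_iff, exists_and_left]
          constructor
          · intro hA
            refine ⟨hA, U0.biUnion fun v => (hA.2 v).toFinset, ?_⟩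
            intro v hv u hu
            exact Finset.mem_biUnion.2 ⟨v, hv, by simpa using hu⟩
          · exact fun h => h.1
        · apply Monotone.directed_le
          intro U U' hUU' A hA
          exact ⟨hA.1, fun v hv u hu => hUU' (hA.2 v hv u hu)⟩
      calc κ = κ * μ (OneE G) := by rw [hO, mul_one]
        _ ≤ _ := by
          rw [h3, ENNReal.mul_iSup]
          exact iSup_le h2
    set W := F.image G.src with hW
    have hF : F ∈ Ch G hlf W := by
      rw [mem_Ch]
      refine ⟨fun e he => Finset.mem_image_of_mem _ he, fun w hw => ?_⟩
      obtain ⟨e, he, rfl⟩ := Finset.mem_image.1 hw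
      exact ⟨e, ⟨he, rfl⟩, fun e2 h => hcons e2 h.1 e he h.2⟩
    have h1 : 1 ≤ ∑ c ∈ Ch G hlf W, L c := by
      refine ge_of_tendsto (tendsto_finsetSum _ fun c _ => hL c) ?_
      filter_upwards [eventually_ge_atTop W] with K hK
      exact wired_sum_ge G hlf K W hK (hN K)
    have h2 := sum_le_one' G hlf μ ν a hν ha hlim W
    rw [← Finset.add_sum_erase _ _ hF] at h1 h2
    have h3 : ∑ c ∈ (Ch G hlf W).erase F, μ (cylE c) ≠ ⊤ :=
      ne_top_of_le_ne_top ENNReal.one_ne_top (le_trans le_add_self h2)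
    have h4 : μ (cylE F) ≤ L F := by
      refine (ENNReal.add_le_add_iff_right h3).1 (h2.trans (h1.trans ?_))
      gcongr with c hc
      exact hle W c (Finset.mem_of_mem_erase hc)
    rw [le_antisymm h4 (hle W F hF)]
    exact hL F
  · push Not at hcons
    obtain ⟨e, he, e2, he2, hs, hne⟩ := hcons
    have h1 : μ (cylE F) = 0 := by
      have h2 : OneE G ⊆ (cylE F)ᶜ := by
        intro A hA hA2
        exact hne ((hA.1 (G.src e)).unique ⟨hA2 e he, rfl⟩ ⟨hA2 e2 he2, hs.symm⟩)
      have h3 := measure_mono (μ := μ) h2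
      rw [hO, prob_compl_eq_one_sub (cylE_meas F)] at h3
      by_contra h0
      have := ENNReal.sub_lt_self (a := 1) ENNReal.one_ne_top one_ne_zero h0
      exact absurd h3 (not_le.2 this)
    rw [h1]
    have h2 : ∀ K : Finset V, wiredUACyl G (K : Set V) F = 0 := by
      intro K
      have : IsEmpty {B : Set E // IsWiredArb G K B ∧ (F : Set E) ⊆ B} := by
        constructor
        rintro ⟨B, hB, hFB⟩
        exact hne ((hB.2.1 (G.src e) (hB.1 e (hFB he))).unique ⟨hFB he, rfl⟩ ⟨hFB he2, hs.symm⟩)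
      rw [wiredUACyl, Nat.card_of_isEmpty]
      simp
    simp_rw [h2]
    exact tendsto_const_nhds

lemma measure_ext_cyl (μ₁ μ₂ : Measure (E → Bool)) (h1 : μ₁ univ = 1) (h2 : μ₂ univ = 1)
    (h : ∀ F : Finset E, μ₁ (cylE F) = μ₂ (cylE F)) : μ₁ = μ₂ := by
  classical
  have : IsProbabilityMeasure μ₁ := ⟨h1⟩
  refine ext_of_generate_finite (range (cylE (E := E))) ?_ ?_ ?_ (by rw [h1, h2])
  · apply le_antisymm
    · refine iSup_le fun e => ?_
      rw [← measurable_iff_comap_le]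
      refine @measurable_to_bool _ (MeasurableSpace.generateFrom (range (cylE (E := E)))) _ ?_
      refine MeasurableSpace.measurableSet_generateFrom ⟨{e}, ?_⟩
      ext A; simp [cylE]
    · refine MeasurableSpace.generateFrom_le ?_
      rintro _ ⟨F, rfl⟩
      exact cylE_meas F
  · rintro _ ⟨F, rfl⟩ _ ⟨F', rfl⟩ _
    refine ⟨F ∪ F', ?_⟩
    ext A
    simp only [cylE, mem_inter_iff, mem_ofPred_eq, Finset.mem_union]
    constructor
    · intro h; exact ⟨fun e he => h e (Or.inl he), fun e he => h e (Or.inr he)⟩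
    · rintro ⟨h, h'⟩ e (he | he)
      · exact h e he
      · exact h' e he
  · rintro _ ⟨F, rfl⟩
    exact h F

end Limit

/-- On an infinite, connected, locally finite, transient digraph there is at
most one Gibbs measure on spanning in-arboreta rooted at infinity supported on configurations
all of whose components are one-ended; moreover any such measure equals the wired uniform
spanning in-arboretum (its cylinder probabilities are the limits of the wired uniform spanning
in-arborescence cylinder probabilities along any exhaustion). -/
theorem stmt15 {V E : Type} [Countable V] [Countable E] [MeasurableSpace V]
    [DiscreteMeasurableSpace V]
    (G : DigraphStruct V E) (hinf : Infinite V) (hconn : G.Connected)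
    (hlf : G.LocallyFinite) (htrans : G.TransientDigraph) :
    (∀ μ₁ μ₂ : Measure (E → Bool),
      IsArbGibbs G μ₁ → μ₁ {A | IsOneEndedSpanningArb G {e : E | A e = true}} = 1 →
      IsArbGibbs G μ₂ → μ₂ {A | IsOneEndedSpanningArb G {e : E | A e = true}} = 1 →
        μ₁ = μ₂) ∧
    (∀ μ : Measure (E → Bool),
      IsArbGibbs G μ → μ {A | IsOneEndedSpanningArb G {e : E | A e = true}} = 1 →
      ∀ Vn : ℕ → Set V, IsExhaustion Vn → ∀ F : Finset E,
        Filter.Tendsto (fun n => wiredUACyl G (Vn n) F) Filter.atTop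
          (nhds (μ {A | ∀ e ∈ F, A e = true}))) := by
  refine ⟨fun μ₁ μ₂ h1 h1' h2 h2' => ?_, fun μ h h' Vn hVn F => ?_⟩
  · refine measure_ext_cyl μ₁ μ₂ h1.1 h2.1 fun F => ?_
    exact tendsto_nhds_unique (main_tendsto G μ₁ hlf htrans h1 h1' F)
      (main_tendsto G μ₂ hlf htrans h2 h2' F)
  · have hT : Tendsto (fun n => (hVn.1 n).toFinset) atTop atTop := by
      apply tendsto_atTop_finset_of_monotone
      · refine monotone_nat_of_le_succ fun n => ?_
        simpa using hVn.2.1 n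
      · intro x
        have : x ∈ ⋃ n, Vn n := by rw [hVn.2.2]; trivial
        obtain ⟨n, hn⟩ := mem_iUnion.1 this
        exact ⟨n, by simpa using hn⟩
    have := (main_tendsto G μ hlf htrans h h' F).comp hT
    have h3 : Tendsto (fun n => wiredUACyl G (Vn n) F) atTop (nhds (μ (cylE F))) := by
      simpa [Function.comp_def] using this
    exact h3

end DF
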